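/- arXiv:2303.09997 — 7 statements merged into one kernel-verified Lean document; each statement's English description precedes it below -/
import Mathlib

section
/- Let E be a meet-semilattice, B an associative ring, and v : E → B a map satisfying v(e ⊓ f) = v(e)·v(f) for all e, f ∈ E (so each v(e) is an idempotent and all the elements v(e) commute). For a finite subset F ⊆ E and a nonempty subset F₀ ⊆ F, write ⋀F₀ for the infimum of F₀ in E and define P_{F₀}^F := ∏_{f ∈ F∖F₀} ( v(⋀F₀) − v(⋀F₀ ⊓ f) ), with the convention P_F^F = v(⋀F). Then: (i) P_{F₀}^F = ∑_{G : F₀ ⊆ G ⊆ F} (−1)^{|G∖F₀|} v(⋀G); (ii) the elements {P_{F₀}^F : ∅ ≠ F₀ ⊆ F} are idempotents and are mutually orthogonal, i.e. P_{F₀}^F · P_{F₁}^F = 0 whenever F₀ ≠ F₁; (iii) for every e ∈ F one has v(e) = ∑_{F₀ : e ∈ F₀ ⊆ F} P_{F₀}^F. -/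
open Finset

/-- The idempotents `P_{F₀}^F` of the inclusion-exclusion principle for a multiplicative
map `v` from a meet-semilattice into a ring: `P_{F₀}^F = ∏_{f ∈ F \ F₀} (v(⋀F₀) - v(⋀F₀ ⊓ f))`,
where the leading idempotent `v(⋀F₀)` is included so that the convention `P_F^F = v(⋀F)`
holds (it is absorbed by every factor, since each factor `v(⋀F₀) - v(⋀F₀ ⊓ f)` satisfies
`v(⋀F₀) * (v(⋀F₀) - v(⋀F₀ ⊓ f)) = v(⋀F₀) - v(⋀F₀ ⊓ f)`). -/
noncomputable def inclusionExclusionIdempotent {E B : Type*} [SemilatticeInf E] [DecidableEq E] [Ring B]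
    (v : E → B) (hv : ∀ e f : E, v (e ⊓ f) = v e * v f)
    (F F₀ : Finset E) (h₀ : F₀.Nonempty) : B :=
  v (F₀.inf' h₀ id) *
    (F \ F₀).noncommProd (fun f => v (F₀.inf' h₀ id) - v (F₀.inf' h₀ id ⊓ f))
      (fun a _ b _ _ => by
        have key : ∀ c d : E, Commute (v c) (v d) := fun c d =>
          show v c * v d = v d * v c by rw [← hv c d, ← hv d c, inf_comm c d]
        exact ((key _ _).sub_right (key _ _)).sub_left ((key _ _).sub_right (key _ _)))

theorem prod_eq_map_inf'_of_map_inf {E A : Type*} [SemilatticeInf E] [CommMonoid A]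
    (w : E → A) (hw : ∀ e f, w (e ⊓ f) = w e * w f) (s : Finset E) (hs : s.Nonempty) :
    w (s.inf' hs id) = ∏ f ∈ s, w f := by
  induction hs using Finset.Nonempty.cons_induction with
  | singleton a => simp
  | cons a s ha hs ih => rw [Finset.inf'_cons hs, hw, ih, Finset.prod_cons, id]

/-- The product of `w f` over `f ∈ s` and of `1 - w f` over `f ∈ F \ s`. -/
def atomProd {E A : Type*} [DecidableEq E] [CommRing A] (w : E → A) (F s : Finset E) : A :=
  (∏ f ∈ s, w f) * ∏ f ∈ F \ s, (1 - w f)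

section AtomProd

variable {E A : Type*} [DecidableEq E] [CommRing A] (w : E → A)

theorem mul_atomProd_of_mem (hw : ∀ e, w e * w e = w e) (F : Finset E) {s : Finset E} {e : E}
    (he : e ∈ s) : w e * atomProd w F s = atomProd w F s := by
  rw [atomProd, ← Finset.mul_prod_erase s w he, ← mul_assoc, ← mul_assoc, hw]

theorem mul_atomProd_of_notMem (hw : ∀ e, w e * w e = w e) {F s : Finset E} {e : E}
    (heF : e ∈ F) (he : e ∉ s) : w e * atomProd w F s = 0 := by
  have h : w e * (1 - w e) = 0 := by rw [mul_sub, mul_one, hw, sub_self]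
  rw [atomProd, ← Finset.mul_prod_erase (F \ s) _ (Finset.mem_sdiff.mpr ⟨heF, he⟩),
    mul_left_comm, ← mul_assoc (w e), h, zero_mul, mul_zero]

theorem atomProd_mul_self (hw : ∀ e, w e * w e = w e) (F s : Finset E) :
    atomProd w F s * atomProd w F s = atomProd w F s := by
  have h (e : E) : (1 - w e) * (1 - w e) = 1 - w e := by linear_combination hw e
  simp only [atomProd, mul_mul_mul_comm, ← Finset.prod_mul_distrib, hw, h]

theorem atomProd_mul_atomProd_of_not_subset (hw : ∀ e, w e * w e = w e) {F s t : Finset E}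
    (hs : s ⊆ F) (hst : ¬ s ⊆ t) : atomProd w F s * atomProd w F t = 0 := by
  obtain ⟨e, hes, het⟩ := Finset.not_subset.mp hst
  rw [← mul_atomProd_of_mem w hw F hes, mul_right_comm,
    mul_atomProd_of_notMem w hw (hs hes) het, zero_mul]

theorem atomProd_mul_atomProd_of_ne (hw : ∀ e, w e * w e = w e) {F s t : Finset E}
    (hs : s ⊆ F) (ht : t ⊆ F) (hst : s ≠ t) : atomProd w F s * atomProd w F t = 0 := by
  by_cases h : s ⊆ t
  · rw [mul_comm]
    exact atomProd_mul_atomProd_of_not_subset w hw ht fun h' => hst (h.antisymm h')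
  · exact atomProd_mul_atomProd_of_not_subset w hw hs h

theorem sum_atomProd (F : Finset E) : ∑ s ∈ F.powerset, atomProd w F s = 1 := by
  simpa [atomProd] using (Finset.prod_add w (fun f => 1 - w f) F).symm

theorem eq_sum_atomProd (hw : ∀ e, w e * w e = w e) {F : Finset E} {e : E} (he : e ∈ F) :
    w e = ∑ s ∈ F.powerset with e ∈ s, atomProd w F s := by
  rw [Finset.sum_filter, ← mul_one (w e), ← sum_atomProd w F, Finset.mul_sum]
  refine Finset.sum_congr rfl fun s _ => ?_
  split_ifs with h
  · exact mul_atomProd_of_mem w hw F h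
  · exact mul_atomProd_of_notMem w hw he h

theorem atomProd_eq_sum {F s : Finset E} (hs : s ⊆ F) :
    atomProd w F s =
      ∑ G ∈ F.powerset with s ⊆ G, (-1) ^ (G \ s).card * ∏ f ∈ G, w f := by
  have h : ∏ f ∈ F \ s, (1 - w f) =
      ∑ H ∈ (F \ s).powerset, (-1) ^ H.card * ∏ f ∈ H, w f := by
    simp only [sub_eq_neg_add, Finset.prod_add, Finset.prod_const_one, mul_one, Finset.prod_neg]
  rw [atomProd, h, Finset.mul_sum]
  refine Finset.sum_bij' (fun H _ => s ∪ H) (fun G _ => G \ s) ?_ ?_ ?_ ?_ ?_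
  · intro H hH
    rw [Finset.mem_powerset, Finset.subset_sdiff] at hH
    simp [Finset.union_subset hs hH.1]
  · intro G hG
    rw [Finset.mem_filter, Finset.mem_powerset] at hG
    exact Finset.mem_powerset.mpr (Finset.sdiff_subset_sdiff hG.1 subset_rfl)
  · intro H hH
    rw [Finset.mem_powerset, Finset.subset_sdiff] at hH
    exact Finset.union_sdiff_cancel_left hH.2.symm
  · intro G hG
    exact Finset.union_sdiff_of_subset (Finset.mem_filter.mp hG).2
  · intro H hH
    rw [Finset.mem_powerset, Finset.subset_sdiff] at hH
    rw [Finset.union_sdiff_cancel_left hH.2.symm, Finset.prod_union hH.2.symm, mul_left_comm]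

end AtomProd

theorem inclusionExclusionIdempotent_eq_map_atomProd {E A B : Type*} [SemilatticeInf E]
    [DecidableEq E] [CommRing A] [Ring B] (φ : A →+* B) (w : E → A) (v : E → B)
    (hv : ∀ e f : E, v (e ⊓ f) = v e * v f) (hw : ∀ e f : E, w (e ⊓ f) = w e * w f)
    (hφ : ∀ e, φ (w e) = v e) (F s : Finset E) (hs : s.Nonempty) :
    inclusionExclusionIdempotent v hv F s hs = φ (atomProd w F s) := by
  have absorb (p : A) (hp : p * p = p) (t : Finset E) :
      p * ∏ f ∈ t, (p - p * w f) = p * ∏ f ∈ t, (1 - w f) := by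
    induction t using Finset.induction_on with
    | empty => simp
    | insert a t ha ih =>
      rw [Finset.prod_insert ha, Finset.prod_insert ha, mul_left_comm, ih]
      linear_combination ((1 - w a) * ∏ f ∈ t, (1 - w f)) * hp
  obtain rfl : v = fun e => φ (w e) := funext fun e => (hφ e).symm
  have hp : w (s.inf' hs id) * w (s.inf' hs id) = w (s.inf' hs id) := by rw [← hw, inf_idem]
  rw [atomProd, ← prod_eq_map_inf'_of_map_inf w hw s hs, ← absorb _ hp, map_mul,
    ← Finset.noncommProd_eq_prod]
  refine congrArg (φ (w (s.inf' hs id)) * ·) (Eq.symm ?_)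
  refine (Finset.map_noncommProd _ _ _ φ).trans (Finset.noncommProd_congr rfl (fun f _ => ?_) _)
  simp only [hw, map_sub]

open scoped IsMulCommutative in
/-- Inclusion-exclusion principle: if `v` is a multiplicative map from a meet-semilattice `E`
to a ring `B` (so the `v e` are commuting idempotents), then for a finite `F ⊆ E` the elements
`P_{F₀}^F` (for nonempty `F₀ ⊆ F`) satisfy:
(i) `P_{F₀}^F = ∑_{F₀ ⊆ G ⊆ F} (-1)^{|G \ F₀|} v(⋀G)`;
(ii) they are idempotents and are mutually orthogonal;
(iii) `v e = ∑_{e ∈ F₀ ⊆ F} P_{F₀}^F` for every `e ∈ F`. -/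
theorem inclusion_exclusion_principle
    {E B : Type*} [SemilatticeInf E] [DecidableEq E] [Ring B]
    (v : E → B) (hv : ∀ e f : E, v (e ⊓ f) = v e * v f) (F : Finset E) :
    (∀ (F₀ : Finset E) (h₀ : F₀.Nonempty), F₀ ⊆ F →
      inclusionExclusionIdempotent v hv F F₀ h₀ =
        ∑ G ∈ (F.powerset.filter fun G => F₀ ⊆ G).attach,
          (-1 : B) ^ ((G.1 \ F₀).card) *
            v (G.1.inf' ⟨h₀.choose, (Finset.mem_filter.mp G.2).2 h₀.choose_spec⟩ id)) ∧
    (∀ (F₀ : Finset E) (h₀ : F₀.Nonempty), F₀ ⊆ F →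
      inclusionExclusionIdempotent v hv F F₀ h₀ * inclusionExclusionIdempotent v hv F F₀ h₀ =
        inclusionExclusionIdempotent v hv F F₀ h₀) ∧
    (∀ (F₀ F₁ : Finset E) (h₀ : F₀.Nonempty) (h₁ : F₁.Nonempty),
      F₀ ⊆ F → F₁ ⊆ F → F₀ ≠ F₁ →
      inclusionExclusionIdempotent v hv F F₀ h₀ * inclusionExclusionIdempotent v hv F F₁ h₁ = 0) ∧
    (∀ e ∈ F,
      v e = ∑ F₀ ∈ (F.powerset.filter fun F₀ => e ∈ F₀).attach,
        inclusionExclusionIdempotent v hv F F₀.1 ⟨e, (Finset.mem_filter.mp F₀.2).2⟩) := by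
  have : IsMulCommutative (Subring.closure (Set.range v)) :=
    Subring.isMulCommutative_closure <| by
      rintro _ ⟨e, rfl⟩ _ ⟨f, rfl⟩
      rw [← hv, ← hv, inf_comm]
  let φ : Subring.closure (Set.range v) →+* B := (Subring.closure (Set.range v)).subtype
  let w (e : E) : Subring.closure (Set.range v) := ⟨v e, Subring.subset_closure ⟨e, rfl⟩⟩
  have hφ (e : E) : φ (w e) = v e := rfl
  have hw (e f : E) : w (e ⊓ f) = w e * w f := Subtype.ext (hv e f)
  have hidem (e : E) : w e * w e = w e := by rw [← hw, inf_idem]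
  have hP (s : Finset E) (hs : s.Nonempty) :
      inclusionExclusionIdempotent v hv F s hs = φ (atomProd w F s) :=
    inclusionExclusionIdempotent_eq_map_atomProd φ w v hv hw hφ F s hs
  have hinf (s : Finset E) (hs : s.Nonempty) : v (s.inf' hs id) = φ (∏ f ∈ s, w f) := by
    rw [← hφ, prod_eq_map_inf'_of_map_inf w hw]
  refine ⟨fun s _ hsF => ?_, fun s _ _ => ?_, fun s t _ _ hs ht hst => ?_, fun e he => ?_⟩
  · rw [Finset.sum_congr rfl fun G _ => congrArg ((-1 : B) ^ (G.1 \ s).card * ·) (hinf G.1 _),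
      Finset.sum_attach _ fun G => (-1 : B) ^ (G \ s).card * φ (∏ f ∈ G, w f), hP,
      atomProd_eq_sum w hsF]
    simp only [map_sum, map_mul, map_pow, map_neg, map_one]
  · rw [hP, ← map_mul, atomProd_mul_self w hidem]
  · rw [hP, hP, ← map_mul, atomProd_mul_atomProd_of_ne w hidem hs ht hst, map_zero]
  · rw [Finset.sum_congr rfl fun s _ => hP s.1 _, Finset.sum_attach _ fun s => φ (atomProd w F s), ← map_sum,
      ← eq_sum_atomProd w hidem he, hφ]
end

section
/- Let p ∈ [1,∞) be a real number, E a Banach space over 𝕜 ∈ {ℝ, ℂ}, and P₁, …, Pₙ ∈ B(E) idempotent operators which are mutually orthogonal (PᵢPⱼ = 0 for i ≠ j) and such that each Pᵢ is an L^p-projection. Then for every x ∈ E one has ‖x‖^p = ∑ᵢ ‖Pᵢ x‖^p + ‖x − ∑ᵢ Pᵢ x‖^p, and consequently for all scalars a₁, …, aₙ ∈ 𝕜 and all x ∈ E, ‖∑ᵢ aᵢ Pᵢ x‖ ≤ (maxᵢ |aᵢ|)·‖x‖; in particular the operator norm of ∑ᵢ aᵢ Pᵢ is at most maxᵢ |aᵢ|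 (mutually orthogonal L^p-projections are jointly contractive). -/
/-- Pairwise orthogonal `L^p`-projections split the `p`-th power of the norm over any finite set. -/
theorem norm_rpow_eq_sum_add_of_orthogonal {𝕜 E ι : Type*} [RCLike 𝕜] [NormedAddCommGroup E]
    [NormedSpace 𝕜 E] (p : ℝ) (P : ι → E →L[𝕜] E)
    (horth : ∀ i j, i ≠ j → (P i).comp (P j) = 0)
    (hLp : ∀ (i : ι) (x : E), ‖x‖ ^ p = ‖P i x‖ ^ p + ‖x - P i x‖ ^ p)
    (s : Finset ι) (x : E) :
    ‖x‖ ^ p = (∑ i ∈ s, ‖P i x‖ ^ p) + ‖x - ∑ i ∈ s, P i x‖ ^ p := by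
  classical
  induction s using Finset.induction_on with
  | empty => simp
  | insert j s hj ih =>
    have hPj : P j (x - ∑ i ∈ s, P i x) = P j x := by
      rw [map_sub, map_sum, Finset.sum_eq_zero, sub_zero]
      intro i hi
      have hji : j ≠ i := fun h => hj (h ▸ hi)
      exact DFunLike.congr_fun (horth j i hji) x
    rw [ih, hLp j (x - ∑ i ∈ s, P i x), hPj, Finset.sum_insert hj, Finset.sum_insert hj,
      sub_sub, add_comm (∑ i ∈ s, P i x) (P j x)]
    ring

/-- Applying one of the projections to a combination of mutually orthogonal projections picks out
the corresponding term. -/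
theorem apply_sum_smul_of_orthogonal {𝕜 E ι : Type*} [RCLike 𝕜] [NormedAddCommGroup E]
    [NormedSpace 𝕜 E] [Fintype ι] (P : ι → E →L[𝕜] E)
    (hidem : ∀ i, (P i).comp (P i) = P i)
    (horth : ∀ i j, i ≠ j → (P i).comp (P j) = 0) (a : ι → 𝕜) (x : E) (j : ι) :
    P j (∑ i, a i • P i x) = a j • P j x := by
  rw [map_sum, Finset.sum_eq_single j]
  · rw [map_smul]
    exact congrArg _ (DFunLike.congr_fun (hidem j) x)
  · intro i _ hij
    have h : P j (P i x) = 0 := DFunLike.congr_fun (horth j i hij.symm) x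
    rw [map_smul, h, smul_zero]
  · simp


/-- Mutually orthogonal `L^p`-projections `P₁, …, Pₙ` on a Banach space `E` over `𝕜 = ℝ, ℂ`
satisfy `‖x‖^p = ∑ᵢ ‖Pᵢ x‖^p + ‖x - ∑ᵢ Pᵢ x‖^p` for every `x`, and consequently they are
jointly contractive: `‖∑ᵢ aᵢ Pᵢ x‖ ≤ (maxᵢ ‖aᵢ‖) ‖x‖` and `‖∑ᵢ aᵢ Pᵢ‖ ≤ maxᵢ ‖aᵢ‖`. -/
theorem lp_projections_jointly_contractive
    {𝕜 E : Type*} [RCLike 𝕜] [NormedAddCommGroup E] [NormedSpace 𝕜 E] [CompleteSpace E]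
    (p : ℝ) (hp : 1 ≤ p) (n : ℕ) (P : Fin n → E →L[𝕜] E)
    (hidem : ∀ i, (P i).comp (P i) = P i)
    (horth : ∀ i j, i ≠ j → (P i).comp (P j) = 0)
    (hLp : ∀ (i : Fin n) (x : E), ‖x‖ ^ p = ‖P i x‖ ^ p + ‖x - P i x‖ ^ p) :
    (∀ x : E, ‖x‖ ^ p = (∑ i, ‖P i x‖ ^ p) + ‖x - ∑ i, P i x‖ ^ p) ∧
    (∀ (a : Fin n → 𝕜) (x : E), ‖∑ i, a i • P i x‖ ≤ (⨆ i, ‖a i‖) * ‖x‖) ∧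
    (∀ a : Fin n → 𝕜, ‖∑ i, a i • P i‖ ≤ ⨆ i, ‖a i‖) := by
  have hsum := fun x => norm_rpow_eq_sum_add_of_orthogonal p P horth hLp Finset.univ x
  have hp0 : 0 < p := one_pos.trans_le hp
  have hM (a : Fin n → 𝕜) : 0 ≤ ⨆ i, ‖a i‖ := Real.iSup_nonneg fun i => norm_nonneg _
  have hcontr (a : Fin n → 𝕜) (x : E) : ‖∑ i, a i • P i x‖ ≤ (⨆ i, ‖a i‖) * ‖x‖ := by
    rw [← Real.rpow_le_rpow_iff (norm_nonneg _) (mul_nonneg (hM a) (norm_nonneg _)) hp0,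
      Real.mul_rpow (hM a) (norm_nonneg _), hsum (∑ i, a i • P i x)]
    simp only [apply_sum_smul_of_orthogonal P hidem horth a x, sub_self, norm_zero,
      Real.zero_rpow hp0.ne', add_zero]
    calc ∑ i, ‖a i • P i x‖ ^ p ≤ ∑ i, (⨆ i, ‖a i‖) ^ p * ‖P i x‖ ^ p := by
          refine Finset.sum_le_sum fun i _ => ?_
          rw [norm_smul, Real.mul_rpow (norm_nonneg _) (norm_nonneg _)]
          gcongr
          exact le_ciSup (Set.finite_range fun i => ‖a i‖).bddAbove i
      _ = (⨆ i, ‖a i‖) ^ p * ∑ i, ‖P i x‖ ^ p := Finset.mul_sum _ _ _ |>.symm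
      _ ≤ (⨆ i, ‖a i‖) ^ p * ‖x‖ ^ p := by
          have := hM a
          gcongr
          rw [hsum x]
          exact le_add_of_nonneg_right (by positivity)
  refine ⟨hsum, hcontr, fun a => ContinuousLinearMap.opNorm_le_bound _ (hM a) fun x => ?_⟩
  simpa using hcontr a x
end

section
/- Let p ∈ [1,∞) be a real number and E a Banach space. Let T, S ∈ B(E) be contractions admitting contractive generalized inverses T*, S* ∈ B(E), and assume that the idempotents T T*, T* T, S S*, S* S are L^p-projections which pairwise commute (for p ≠ 2 this commutation is automatic, since all L^p-projections on a Banach space commute). Then S* T* is a contractive generalized inverse of T S, i.e. (T S)(S* T*)(T S) = T S and (S* T*)(T S)(S* T*) = S* T*, and both idempotents T S S* T* and S* T* T S are again L^p-projections; in particular ‖T S S* T* x‖^p = ‖x‖^p − ‖(1 − T S S* T*) x‖^p for every x ∈ E. -/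
/-- An idempotent bounded operator `P` on a Banach space `E` is an `L^p`-projection if
`‖x‖^p = ‖P x‖^p + ‖x - P x‖^p` for every `x ∈ E`. -/
def IsLpProjection {E : Type*} [NormedAddCommGroup E] [NormedSpace ℝ E]
    (p : ℝ) (P : E →L[ℝ] E) : Prop :=
  P * P = P ∧ ∀ x : E, ‖x‖ ^ p = ‖P x‖ ^ p + ‖x - P x‖ ^ p

/-- If `T` and `Ts` are contractions with `T * Ts * T = T`, then `‖T y‖ = ‖Ts (T y)‖`. -/
theorem norm_apply_eq_norm_generalizedInverse_apply
    {E : Type*} [NormedAddCommGroup E] [NormedSpace ℝ E] {T Ts : E →L[ℝ] E}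
    (hT : ‖T‖ ≤ 1) (hTs : ‖Ts‖ ≤ 1) (h : T * Ts * T = T) (y : E) :
    ‖T y‖ = ‖Ts (T y)‖ := by
  have hy : T (Ts (T y)) = T y := DFunLike.congr_fun h y
  refine le_antisymm ?_ ?_
  · simpa [hy] using T.le_of_opNorm_le hT (Ts (T y))
  · simpa using Ts.le_of_opNorm_le hTs (T y)

/-- Conjugating an `L^p`-projection `B` by an `L^p`-partial isometry `T` whose initial projection
`Ts * T` commutes with `B` yields an `L^p`-projection. -/
theorem IsLpProjection.conj_generalizedInverse
    {E : Type*} [NormedAddCommGroup E] [NormedSpace ℝ E] {p : ℝ} {T Ts B : E →L[ℝ] E}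
    (hT : ‖T‖ ≤ 1) (hTs : ‖Ts‖ ≤ 1) (h1 : T * Ts * T = T) (h2 : Ts * T * Ts = Ts)
    (hP : IsLpProjection p (T * Ts)) (hB : IsLpProjection p B)
    (hc : Ts * T * B = B * (Ts * T)) :
    IsLpProjection p (T * B * Ts) := by
  have e2 (y : E) : Ts (T (Ts y)) = Ts y := DFunLike.congr_fun h2 y
  have ec (y : E) : Ts (T (B y)) = B (Ts (T y)) := DFunLike.congr_fun hc y
  have eB (y : E) : B (B y) = B y := DFunLike.congr_fun hB.1 y
  refine ⟨?_, fun x => ?_⟩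
  · ext x
    simp [ec, eB, e2]
  · have hx := hP.2 x
    have hq := hP.2 (x - T (B (Ts x)))
    have hb := hB.2 (Ts x)
    have n1 := norm_apply_eq_norm_generalizedInverse_apply hTs hT h2 x
    have n2 := norm_apply_eq_norm_generalizedInverse_apply hT hTs h1 (B (Ts x))
    have n3 := norm_apply_eq_norm_generalizedInverse_apply hT hTs h1 (Ts x - B (Ts x))
    simp only [mul_apply_eq_comp, map_sub, e2, ec,
      sub_sub_sub_cancel_right] at hx hq hb n1 n2 n3 ⊢
    rw [hx, hq, ← n1, hb, n2, n3]
    ring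

/-- If `T, S` are contractions on a Banach space `E` with contractive generalized inverses
`T*, S*` such that the idempotents `T T*, T* T, S S*, S* S` are pairwise commuting
`L^p`-projections, then `S* T*` is a contractive generalized inverse of `T S` and the
idempotents `T S S* T*` and `S* T* T S` are again `L^p`-projections; in particular
`‖T S S* T* x‖^p = ‖x‖^p - ‖(1 - T S S* T*) x‖^p` for every `x ∈ E`. -/
theorem lp_partial_isometries_compose
    {E : Type*} [NormedAddCommGroup E] [NormedSpace ℝ E] [CompleteSpace E]
    (p : ℝ) (hp : 1 ≤ p)
    (T Ts S Ss : E →L[ℝ] E)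
    (hTn : ‖T‖ ≤ 1) (hTsn : ‖Ts‖ ≤ 1) (hSn : ‖S‖ ≤ 1) (hSsn : ‖Ss‖ ≤ 1)
    (hT1 : T * Ts * T = T) (hT2 : Ts * T * Ts = Ts)
    (hS1 : S * Ss * S = S) (hS2 : Ss * S * Ss = Ss)
    (hTTs : IsLpProjection p (T * Ts)) (hTsT : IsLpProjection p (Ts * T))
    (hSSs : IsLpProjection p (S * Ss)) (hSsS : IsLpProjection p (Ss * S))
    (hcomm : ∀ P Q : E →L[ℝ] E,
      P ∈ ({T * Ts, Ts * T, S * Ss, Ss * S} : Set (E →L[ℝ] E)) →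
      Q ∈ ({T * Ts, Ts * T, S * Ss, Ss * S} : Set (E →L[ℝ] E)) →
      P * Q = Q * P) :
    (T * S) * (Ss * Ts) * (T * S) = T * S ∧
    (Ss * Ts) * (T * S) * (Ss * Ts) = Ss * Ts ∧
    IsLpProjection p (T * S * (Ss * Ts)) ∧
    IsLpProjection p (Ss * Ts * (T * S)) ∧
    (∀ x : E, ‖(T * S * (Ss * Ts)) x‖ ^ p = ‖x‖ ^ p - ‖x - (T * S * (Ss * Ts)) x‖ ^ p) := by
  have hc : Ts * T * (S * Ss) = S * Ss * (Ts * T) := hcomm _ _ (by simp) (by simp)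
  have hQ : IsLpProjection p (T * S * (Ss * Ts)) := by
    simpa only [mul_assoc] using hTTs.conj_generalizedInverse hTn hTsn hT1 hT2 hSSs hc
  have hR : IsLpProjection p (Ss * Ts * (T * S)) := by
    simpa only [mul_assoc] using hSsS.conj_generalizedInverse hSsn hSn hS2 hS1 hTsT hc.symm
  refine ⟨?_, ?_, hQ, hR, fun x => eq_sub_of_add_eq (hQ.2 x).symm⟩
  · calc T * S * (Ss * Ts) * (T * S) = T * (S * Ss * (Ts * T)) * S := by simp only [mul_assoc]
      _ = (T * Ts * T) * (S * Ss * S) := by rw [← hc]; simp only [mul_assoc]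
      _ = T * S := by rw [hT1, hS1]
  · calc Ss * Ts * (T * S) * (Ss * Ts) = Ss * (Ts * T * (S * Ss)) * Ts := by
          simp only [mul_assoc]
      _ = (Ss * S * Ss) * (Ts * T * Ts) := by rw [hc]; simp only [mul_assoc]
      _ = Ss * Ts := by rw [hS2, hT2]
end

section
/- Let p ∈ [1,∞) be a real number, let (α, μ) and (β, ν) be σ-finite measure spaces, and let φ : α → β be a measurable equivalence (a bijection which is measurable with measurable inverse). Assume that the pushforward measure φ⁻¹_*ν on α (the measure A ↦ ν(φ(A)), i.e. the image of ν under φ⁻¹) is absolutely continuous with respect to μ, and let w be the Radon–Nikodym derivative d(φ⁻¹_*ν)/dμ. Then for every measurable ξ : β → ℂ one has ∫_α w(x)·|ξ(φ(x))|^p dμ(x) = ∫_β |ξ(y)|^p dν(y); hence U(ξ) := w^{1/p}·(ξ ∘ φ) defines a linear isometry from L^p(ν) to L^p(μ). If moreover μ is absolutely continuous with respect to φ⁻¹_*ν, then U is a surjective (invertible) isometry, and for every measurable ω : α → ℂ with |ω(x)| = 1 for μ-almost every x, the map ξ ↦ ω · w^{1/p} · (ξ ∘ φ) is also a surjective isometry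 from L^p(ν) onto L^p(μ). -/
open MeasureTheory
open scoped ENNReal

/-- Change of variables: the density `d(φ⁻¹_*ν)/dμ` turns integrals along `φ` into integrals
against `ν`. -/
theorem lintegral_rnDeriv_map_symm_mul {α β : Type*} [MeasurableSpace α] [MeasurableSpace β]
    (μ : Measure α) (ν : Measure β) [SigmaFinite μ] [SigmaFinite ν] (φ : α ≃ᵐ β)
    (hac : ν.map φ.symm ≪ μ) (f : β → ℝ≥0∞) (hf : Measurable f) :
    ∫⁻ x, (ν.map φ.symm).rnDeriv μ x * f (φ x) ∂μ = ∫⁻ y, f y ∂ν := by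
  have : SigmaFinite (ν.map φ.symm) := φ.symm.sigmaFinite_map
  have h := lintegral_rnDeriv_mul hac (hf.comp φ.measurable).aemeasurable
  simp only [Function.comp_apply] at h
  rw [h, lintegral_map_equiv]
  simp

/-- A `ν`-a.e. property holds along `φ` at `μ`-a.e. point where the density does not vanish. -/
theorem ae_comp_of_rnDeriv_ne_zero {α β : Type*} [MeasurableSpace α] [MeasurableSpace β]
    (μ : Measure α) (ν : Measure β) [SigmaFinite μ] [SigmaFinite ν] (φ : α ≃ᵐ β)
    (hac : ν.map φ.symm ≪ μ) {P : β → Prop} (hP : ∀ᵐ y ∂ν, P y) :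
    ∀ᵐ x ∂μ, (ν.map φ.symm).rnDeriv μ x ≠ 0 → P (φ x) := by
  have : SigmaFinite (ν.map φ.symm) := φ.symm.sigmaFinite_map
  rw [← ae_withDensity_iff (Measure.measurable_rnDeriv _ _), Measure.withDensity_rnDeriv_eq _ _ hac]
  refine (φ.symm.measurableEmbedding.ae_map_iff).2 ?_
  simpa using hP

/-- A weight of modulus `(d(φ⁻¹_*ν)/dμ)^{1/p}` makes the weighted composition operator along `φ`
preserve the `L^p`-seminorm. -/
theorem eLpNorm_weight_mul_comp {α β : Type*} [MeasurableSpace α] [MeasurableSpace β]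
    (μ : Measure α) (ν : Measure β) [SigmaFinite μ] [SigmaFinite ν] (p : ℝ) (hp : 1 ≤ p)
    (φ : α ≃ᵐ β) (hac : ν.map φ.symm ≪ μ) (W : α → ℂ)
    (hW : ∀ᵐ x ∂μ, ‖W x‖ = ((ν.map φ.symm).rnDeriv μ x).toReal ^ (1 / p))
    (f : β → ℂ) (hf : Measurable f) :
    eLpNorm (fun x => W x * f (φ x)) (ENNReal.ofReal p) μ = eLpNorm f (ENNReal.ofReal p) ν := by
  have hp0 : 0 < p := by linarith
  have : SigmaFinite (ν.map φ.symm) := φ.symm.sigmaFinite_map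
  have h0 : ENNReal.ofReal p ≠ 0 := by simpa using hp0
  rw [eLpNorm_eq_lintegral_rpow_enorm_toReal h0 ENNReal.ofReal_ne_top,
    eLpNorm_eq_lintegral_rpow_enorm_toReal h0 ENNReal.ofReal_ne_top,
    ENNReal.toReal_ofReal hp0.le,
    ← lintegral_rnDeriv_map_symm_mul μ ν φ hac (fun y => ‖f y‖ₑ ^ p) (by fun_prop)]
  congr 1
  refine lintegral_congr_ae ?_
  filter_upwards [hW, Measure.rnDeriv_lt_top (ν.map φ.symm) μ] with x hx hlt
  rw [enorm_mul, ENNReal.mul_rpow_of_nonneg _ _ hp0.le]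
  congr 1
  rw [← ofReal_norm, hx, ← ENNReal.ofReal_rpow_of_nonneg ENNReal.toReal_nonneg
    (by positivity), ENNReal.ofReal_toReal hlt.ne, ← ENNReal.rpow_mul, one_div_mul_cancel hp0.ne',
    ENNReal.rpow_one]

/-- The weighted composition operator along `φ` as a linear isometry of `L^p`-spaces. -/
theorem exists_linearIsometry_weight_mul_comp {α β : Type*} [MeasurableSpace α]
    [MeasurableSpace β] (μ : Measure α) (ν : Measure β) [SigmaFinite μ] [SigmaFinite ν]
    (p : ℝ) (hp : 1 ≤ p) [Fact (1 ≤ ENNReal.ofReal p)]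
    (φ : α ≃ᵐ β) (hac : ν.map φ.symm ≪ μ) (W : α → ℂ) (hWm : Measurable W)
    (hW : ∀ᵐ x ∂μ, ‖W x‖ = ((ν.map φ.symm).rnDeriv μ x).toReal ^ (1 / p)) :
    ∃ U : Lp ℂ (ENNReal.ofReal p) ν →ₗᵢ[ℂ] Lp ℂ (ENNReal.ofReal p) μ,
      ∀ ξ : Lp ℂ (ENNReal.ofReal p) ν, ⇑(U ξ) =ᵐ[μ] fun x => W x * ξ (φ x) := by
  have hp0 : 0 < p := by linarith
  have hmeas (f : Lp ℂ (ENNReal.ofReal p) ν) : Measurable f := (Lp.stronglyMeasurable f).measurable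
  have hnorm (f : Lp ℂ (ENNReal.ofReal p) ν) :=
    eLpNorm_weight_mul_comp μ ν p hp φ hac W hW f (hmeas f)
  have hmem (f : Lp ℂ (ENNReal.ofReal p) ν) :
      MemLp (fun x => W x * f (φ x)) (ENNReal.ofReal p) μ :=
    ⟨(hWm.mul ((hmeas f).comp φ.measurable)).aestronglyMeasurable,
      (hnorm f).trans_lt (Lp.memLp f).2⟩
  have hae {P : β → Prop} (hP : ∀ᵐ y ∂ν, P y) : ∀ᵐ x ∂μ, W x = 0 ∨ P (φ x) := by
    filter_upwards [ae_comp_of_rnDeriv_ne_zero μ ν φ hac hP, hW] with x hx hWx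
    by_cases h : (ν.map φ.symm).rnDeriv μ x = 0
    · left
      rw [h, ENNReal.toReal_zero, Real.zero_rpow (by positivity)] at hWx
      exact norm_eq_zero.1 hWx
    · exact Or.inr (hx h)
  refine ⟨{ toFun := fun f => (hmem f).toLp, map_add' := ?_, map_smul' := ?_, norm_map' := ?_ },
    fun f => (hmem f).coeFn_toLp⟩
  · intro f g
    rw [← MemLp.toLp_add]
    refine MemLp.toLp_congr _ _ ?_
    filter_upwards [hae (Lp.coeFn_add f g)] with x hx
    rcases hx with hx | hx
    · simp [hx]
    · simp only [Pi.add_apply, hx, mul_add]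
  · intro c f
    rw [RingHom.id_apply, ← MemLp.toLp_const_smul]
    refine MemLp.toLp_congr _ _ ?_
    filter_upwards [hae (Lp.coeFn_smul c f)] with x hx
    rcases hx with hx | hx
    · simp [hx]
    · simp [hx, mul_left_comm]
  · intro f
    change ‖(hmem f).toLp‖ = ‖f‖
    rw [Lp.norm_toLp, hnorm, Lp.norm_def]

/-- If `μ` and `φ⁻¹_*ν` are equivalent, the weighted composition operator along `φ` is an
invertible linear isometry of `L^p`-spaces. -/
theorem exists_linearIsometryEquiv_weight_mul_comp {α β : Type*} [MeasurableSpace α]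
    [MeasurableSpace β] (μ : Measure α) (ν : Measure β) [SigmaFinite μ] [SigmaFinite ν]
    (p : ℝ) (hp : 1 ≤ p) [Fact (1 ≤ ENNReal.ofReal p)]
    (φ : α ≃ᵐ β) (hac : ν.map φ.symm ≪ μ) (hac' : μ ≪ ν.map φ.symm)
    (W : α → ℂ) (hWm : Measurable W)
    (hW : ∀ᵐ x ∂μ, ‖W x‖ = ((ν.map φ.symm).rnDeriv μ x).toReal ^ (1 / p)) :
    ∃ U : Lp ℂ (ENNReal.ofReal p) ν ≃ₗᵢ[ℂ] Lp ℂ (ENNReal.ofReal p) μ,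
      ∀ ξ : Lp ℂ (ENNReal.ofReal p) ν, ⇑(U ξ) =ᵐ[μ] fun x => W x * ξ (φ x) := by
  have : SigmaFinite (ν.map φ.symm) := φ.symm.sigmaFinite_map
  have hpos : ∀ᵐ x ∂μ, (ν.map φ.symm).rnDeriv μ x ≠ 0 :=
    (Measure.rnDeriv_pos' hac').mono fun x hx => hx.ne'
  have hW0 : ∀ᵐ x ∂μ, W x ≠ 0 := by
    filter_upwards [hpos, hW, Measure.rnDeriv_lt_top (ν.map φ.symm) μ] with x hx hWx hlt
    have := Real.rpow_pos_of_pos (ENNReal.toReal_pos hx hlt.ne) (1 / p)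
    rw [← hWx] at this
    exact norm_pos_iff.1 this
  obtain ⟨U, hU⟩ := exists_linearIsometry_weight_mul_comp μ ν p hp φ hac W hWm hW
  refine ⟨LinearIsometryEquiv.ofSurjective U fun g => ?_, hU⟩
  have hg : Measurable g := (Lp.stronglyMeasurable g).measurable
  set f : β → ℂ := fun y => (W (φ.symm y))⁻¹ * g (φ.symm y) with hf_def
  have hf : Measurable f :=
    (hWm.comp φ.symm.measurable).inv.mul (hg.comp φ.symm.measurable)
  have hfg : (fun x => W x * f (φ x)) =ᵐ[μ] g := by
    filter_upwards [hW0] with x hx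
    simp [hf_def, hx]
  have hfL : MemLp f (ENNReal.ofReal p) ν := by
    refine ⟨hf.aestronglyMeasurable, ?_⟩
    rw [← eLpNorm_weight_mul_comp μ ν p hp φ hac W hW f hf, eLpNorm_congr_ae hfg]
    exact (Lp.memLp g).2
  refine ⟨hfL.toLp, Lp.ext ((hU _).trans (.trans ?_ hfg))⟩
  filter_upwards [ae_comp_of_rnDeriv_ne_zero μ ν φ hac hfL.coeFn_toLp, hpos] with x hx hx0
  rw [hx hx0]

/-- Spatial isometries of `L^p`-spaces: if `φ : α ≃ᵐ β` is a measurable equivalence of σ-finite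
measure spaces with `φ⁻¹_*ν ≪ μ` and `w = d(φ⁻¹_*ν)/dμ`, then
`∫ w |ξ ∘ φ|^p dμ = ∫ |ξ|^p dν` for every measurable `ξ`, so `ξ ↦ w^{1/p}·(ξ ∘ φ)` defines a
linear isometry `L^p(ν) → L^p(μ)`; if moreover `μ ≪ φ⁻¹_*ν`, this isometry is invertible, and
so is `ξ ↦ ω·w^{1/p}·(ξ ∘ φ)` for any unimodular weight `ω`. -/
theorem spatial_isometries_on_Lp
    {α β : Type*} [MeasurableSpace α] [MeasurableSpace β]
    (μ : Measure α) (ν : Measure β) [SigmaFinite μ] [SigmaFinite ν]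
    (p : ℝ) (hp : 1 ≤ p) [Fact (1 ≤ ENNReal.ofReal p)]
    (φ : α ≃ᵐ β)
    (hac : ν.map φ.symm ≪ μ) :
    (∀ ξ : β → ℂ, Measurable ξ →
      ∫⁻ x, (ν.map φ.symm).rnDeriv μ x * (‖ξ (φ x)‖₊ : ℝ≥0∞) ^ p ∂μ
        = ∫⁻ y, (‖ξ y‖₊ : ℝ≥0∞) ^ p ∂ν) ∧
    (∃ U : Lp ℂ (ENNReal.ofReal p) ν →ₗᵢ[ℂ] Lp ℂ (ENNReal.ofReal p) μ,
      ∀ ξ : Lp ℂ (ENNReal.ofReal p) ν,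
        ⇑(U ξ) =ᵐ[μ]
          fun x => ((((ν.map φ.symm).rnDeriv μ x).toReal ^ (1 / p) : ℝ) : ℂ) * ξ (φ x)) ∧
    (μ ≪ ν.map φ.symm →
      (∃ U : Lp ℂ (ENNReal.ofReal p) ν ≃ₗᵢ[ℂ] Lp ℂ (ENNReal.ofReal p) μ,
        ∀ ξ : Lp ℂ (ENNReal.ofReal p) ν,
          ⇑(U ξ) =ᵐ[μ]
            fun x => ((((ν.map φ.symm).rnDeriv μ x).toReal ^ (1 / p) : ℝ) : ℂ) * ξ (φ x)) ∧
      (∀ ω : α → ℂ, Measurable ω → (∀ᵐ x ∂μ, ‖ω x‖ = 1) →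
        ∃ U : Lp ℂ (ENNReal.ofReal p) ν ≃ₗᵢ[ℂ] Lp ℂ (ENNReal.ofReal p) μ,
          ∀ ξ : Lp ℂ (ENNReal.ofReal p) ν,
            ⇑(U ξ) =ᵐ[μ]
              fun x => ω x * ((((ν.map φ.symm).rnDeriv μ x).toReal ^ (1 / p) : ℝ) : ℂ)
                * ξ (φ x))) := by
  have hnn (x : α) : 0 ≤ ((ν.map φ.symm).rnDeriv μ x).toReal ^ (1 / p) :=
    Real.rpow_nonneg ENNReal.toReal_nonneg _
  have hwm : Measurable fun x =>
      ((((ν.map φ.symm).rnDeriv μ x).toReal ^ (1 / p) : ℝ) : ℂ) :=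
    Complex.measurable_ofReal.comp ((Measure.measurable_rnDeriv _ _).ennreal_toReal.pow_const _)
  have hw : ∀ᵐ x ∂μ, ‖((((ν.map φ.symm).rnDeriv μ x).toReal ^ (1 / p) : ℝ) : ℂ)‖
      = ((ν.map φ.symm).rnDeriv μ x).toReal ^ (1 / p) :=
    .of_forall fun x => Complex.norm_of_nonneg (hnn x)
  refine ⟨fun ξ hξ => lintegral_rnDeriv_map_symm_mul μ ν φ hac (fun y => (‖ξ y‖₊ : ℝ≥0∞) ^ p)
      (by fun_prop),
    exists_linearIsometry_weight_mul_comp μ ν p hp φ hac _ hwm hw, fun hac' =>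
    ⟨exists_linearIsometryEquiv_weight_mul_comp μ ν p hp φ hac hac' _ hwm hw, fun ω hω hω1 =>
      exists_linearIsometryEquiv_weight_mul_comp μ ν p hp φ hac hac' _ (hω.mul hwm) ?_⟩⟩
  filter_upwards [hω1, hw] with x h1 h2
  rw [norm_mul, h1, h2, one_mul]
end

section
/- Let Ω be a locally compact Hausdorff space, let φ, ψ : Ω → Ω be homeomorphisms, and let ω, υ : Ω → ℂ be continuous functions with |ω(x)| = |υ(x)| = 1 for all x ∈ Ω. Define the weighted composition operators u, v on C₀(Ω, ℂ) by (u ξ)(x) = ω(x)·ξ(φ(x)) and (v ξ)(x) = υ(x)·ξ(ψ(x)); these are invertible isometries. Then the operator norm of u − v satisfies ‖u − v‖ = max{ sup_{x∈Ω} |ω(x) − υ(x)| , 2·(1 − δ_{φ,ψ}) }; explicitly, if φ = ψ then ‖u − v‖ = sup_{x∈Ω} |ω(x) − υ(x)|, while if φ ≠ ψ then ‖u − v‖ = 2. -/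
open scoped ZeroAtInfty

namespace ZeroAtInftyContinuousMap

variable {X : Type*} [TopologicalSpace X]

theorem norm_apply_le_norm (ξ : C₀(X, ℂ)) (x : X) : ‖ξ x‖ ≤ ‖ξ‖ :=
  ξ.toBCF.norm_coe_le_norm x

theorem norm_le_of_forall_norm_apply_le {ξ : C₀(X, ℂ)} {C : ℝ} (hC : 0 ≤ C)
    (h : ∀ x, ‖ξ x‖ ≤ C) : ‖ξ‖ ≤ C :=
  (BoundedContinuousFunction.norm_le (f := ξ.toBCF) hC).2 h

theorem norm_apply_le_opNorm (T : C₀(X, ℂ) →L[ℂ] C₀(X, ℂ)) {ξ : C₀(X, ℂ)} (hξ : ‖ξ‖ ≤ 1)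
    (x : X) : ‖T ξ x‖ ≤ ‖T‖ :=
  (norm_apply_le_norm _ x).trans (T.unit_le_opNorm ξ hξ)

theorem exists_norm_le_one_apply_eq_one [LocallyCompactSpace X] [T2Space X] (a : X) :
    ∃ ξ : C₀(X, ℂ), ‖ξ‖ ≤ 1 ∧ ξ a = 1 := by
  obtain ⟨f, hfa, -, hfc, hf⟩ := exists_continuous_one_zero_of_isCompact
    (isCompact_singleton (x := a)) isClosed_empty (Set.disjoint_empty _)
  have hc : HasCompactSupport (fun x ↦ (f x : ℂ)) := hfc.comp_left Complex.ofReal_zero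
  refine ⟨⟨⟨fun x ↦ (f x : ℂ), by fun_prop⟩, hc.is_zero_at_infty⟩,
    norm_le_of_forall_norm_apply_le zero_le_one fun x ↦ ?_, ?_⟩
  · change ‖(f x : ℂ)‖ ≤ 1
    rw [Complex.norm_real, Real.norm_of_nonneg (hf x).1]
    exact (hf x).2
  · change (f a : ℂ) = 1
    simp [hfa rfl]

theorem exists_norm_le_one_apply_eq_apply_eq [LocallyCompactSpace X] [T2Space X] {a b : X}
    (hab : a ≠ b) {α β : ℂ} (hα : ‖α‖ ≤ 1) (hβ : ‖β‖ ≤ 1) :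
    ∃ ξ : C₀(X, ℂ), ‖ξ‖ ≤ 1 ∧ ξ a = α ∧ ξ b = β := by
  obtain ⟨f, hfa, -, hfc, hf⟩ := exists_continuous_one_zero_of_isCompact
    (isCompact_singleton (x := a)) isClosed_empty (Set.disjoint_empty _)
  obtain ⟨g, hgb, hga, hgc, hg⟩ := exists_continuous_one_zero_of_isCompact
    (isCompact_singleton (x := b)) (isClosed_singleton (x := a)) (by simpa using hab.symm)
  have hfc' : HasCompactSupport (fun x ↦ (f x : ℂ)) := hfc.comp_left Complex.ofReal_zero
  have hgc' : HasCompactSupport (fun x ↦ (g x : ℂ)) := hgc.comp_left Complex.ofReal_zero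
  have hc : HasCompactSupport (fun x ↦ (f x : ℂ) * (α * (1 - g x)) + (g x : ℂ) * β) :=
    (hfc'.mul_right (f' := fun x ↦ α * (1 - g x))).add (hgc'.mul_right (f' := fun _ ↦ β))
  refine ⟨⟨⟨fun x ↦ (f x : ℂ) * (α * (1 - g x)) + (g x : ℂ) * β, by fun_prop⟩,
    hc.is_zero_at_infty⟩, norm_le_of_forall_norm_apply_le zero_le_one fun x ↦ ?_, ?_, ?_⟩
  · obtain ⟨hf0, hf1⟩ := hf x
    obtain ⟨hg0, hg1⟩ := hg x
    have h1g : ‖(1 - g x : ℂ)‖ = 1 - g x := by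
      rw [← Complex.ofReal_one, ← Complex.ofReal_sub, Complex.norm_real,
        Real.norm_of_nonneg (sub_nonneg.2 hg1)]
    change ‖(f x : ℂ) * (α * (1 - g x)) + (g x : ℂ) * β‖ ≤ 1
    calc _ ≤ ‖(f x : ℂ) * (α * (1 - g x))‖ + ‖(g x : ℂ) * β‖ := norm_add_le _ _
      _ = f x * (‖α‖ * (1 - g x)) + g x * ‖β‖ := by
        rw [norm_mul, norm_mul, norm_mul, h1g, Complex.norm_real, Complex.norm_real,
          Real.norm_of_nonneg hf0, Real.norm_of_nonneg hg0]
      _ ≤ 1 * (1 * (1 - g x)) + g x * 1 := by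
        have := sub_nonneg.2 hg1
        gcongr
      _ = 1 := by ring
  · change (f a : ℂ) * (α * (1 - g a)) + (g a : ℂ) * β = α
    simp [hfa rfl, hga rfl]
  · change (f b : ℂ) * (α * (1 - g b)) + (g b : ℂ) * β = β
    simp [hgb rfl]

end ZeroAtInftyContinuousMap

open ZeroAtInftyContinuousMap

/-- Distance between weighted composition operators on `C₀(Ω, ℂ)`: if
`(u ξ)(x) = ω(x)·ξ(φ(x))` and `(v ξ)(x) = υ(x)·ξ(ψ(x))` for homeomorphisms `φ, ψ` of a locally
compact Hausdorff space `Ω` and unimodular continuous weights `ω, υ`, then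
`‖u - v‖ = max { sup_x |ω(x) - υ(x)| , 2 (1 - δ_{φ,ψ}) }`: explicitly, if `φ = ψ` then
`‖u - v‖ = sup_x |ω(x) - υ(x)|`, while if `φ ≠ ψ` then `‖u - v‖ = 2`. -/
theorem weighted_composition_operator_distance
    {Ω : Type*} [TopologicalSpace Ω] [LocallyCompactSpace Ω] [T2Space Ω]
    (φ ψ : Ω ≃ₜ Ω) (ω υ : Ω → ℂ)
    (hωc : Continuous ω) (hυc : Continuous υ)
    (hω1 : ∀ x, ‖ω x‖ = 1) (hυ1 : ∀ x, ‖υ x‖ = 1)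
    (u v : C₀(Ω, ℂ) →L[ℂ] C₀(Ω, ℂ))
    (hu : ∀ (ξ : C₀(Ω, ℂ)) (x : Ω), u ξ x = ω x * ξ (φ x))
    (hv : ∀ (ξ : C₀(Ω, ℂ)) (x : Ω), v ξ x = υ x * ξ (ψ x)) :
    (φ = ψ → ‖u - v‖ = ⨆ x : Ω, ‖ω x - υ x‖) ∧ (φ ≠ ψ → ‖u - v‖ = 2) := by
  have huv : ∀ ξ x, (u - v) ξ x = ω x * ξ (φ x) - υ x * ξ (ψ x) := fun ξ x ↦ by
    rw [← hu, ← hv]; rfl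
  have hle : ∀ x, ‖ω x - υ x‖ ≤ 2 := fun x ↦
    (norm_sub_le _ _).trans (by rw [hω1, hυ1]; norm_num)
  constructor
  · rintro rfl
    have hnonneg : 0 ≤ ⨆ x, ‖ω x - υ x‖ := Real.iSup_nonneg fun _ ↦ norm_nonneg _
    refine le_antisymm (ContinuousLinearMap.opNorm_le_bound _ hnonneg fun ξ ↦ ?_)
      (Real.iSup_le (fun x ↦ ?_) (ContinuousLinearMap.opNorm_nonneg _))
    · refine norm_le_of_forall_norm_apply_le (by positivity) fun x ↦ ?_
      rw [huv, ← sub_mul, norm_mul]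
      exact mul_le_mul (le_ciSup (f := fun x ↦ ‖ω x - υ x‖)
        ⟨2, Set.forall_mem_range.2 hle⟩ x) (norm_apply_le_norm _ _) (norm_nonneg _) hnonneg
    · obtain ⟨ξ, hξ, hx⟩ := exists_norm_le_one_apply_eq_one (φ x)
      have h := norm_apply_le_opNorm (u - v) hξ x
      rwa [huv, hx, mul_one, mul_one] at h
  · intro hne
    obtain ⟨x, hx⟩ : ∃ x, φ x ≠ ψ x := by
      by_contra! h
      exact hne (Homeomorph.ext h)
    refine le_antisymm (ContinuousLinearMap.opNorm_le_bound _ zero_le_two fun ξ ↦ ?_) ?_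
    · refine norm_le_of_forall_norm_apply_le (by positivity) fun y ↦ ?_
      rw [huv]
      refine (norm_sub_le _ _).trans ?_
      rw [norm_mul, norm_mul, hω1, hυ1]
      linarith [norm_apply_le_norm ξ (φ y), norm_apply_le_norm ξ (ψ y)]
    · obtain ⟨ξ, hξ, hξφ, hξψ⟩ := exists_norm_le_one_apply_eq_apply_eq hx
        (α := (ω x)⁻¹) (β := -(υ x)⁻¹) (by simp [hω1]) (by simp [hυ1])
      have hω0 : ω x ≠ 0 := norm_ne_zero_iff.1 (by simp [hω1])
      have hυ0 : υ x ≠ 0 := norm_ne_zero_iff.1 (by simp [hυ1])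
      have h2 : (u - v) ξ x = 2 := by
        rw [huv, hξφ, hξψ, mul_neg, mul_inv_cancel₀ hω0, mul_inv_cancel₀ hυ0]
        norm_num
      have h := norm_apply_le_opNorm (u - v) hξ x
      rwa [h2, Complex.norm_two] at h
end

section
/- Let X be a locally compact Hausdorff space, let p ∈ [1,∞) be a real number with p ≠ 2, let (Ω, Σ, μ) be a σ-finite measure space, and let π : C₀(X, ℂ) → B(L^p(μ, ℂ)) be a non-degenerate representation, i.e. a contractive algebra homomorphism such that the closed linear span of {π(a)ξ : a ∈ C₀(X, ℂ), ξ ∈ L^p(μ, ℂ)} equals L^p(μ, ℂ). Then π acts by multiplication operators: there exists a linear multiplicative map π₀ assigning to each a ∈ C₀(X, ℂ) an (equivalence class of an) essentially bounded measurable function π₀(a) : Ω → ℂ with essential supremum norm ‖π₀(a)‖_∞ ≤ ‖a‖_∞, such that π(a)ξ = π₀(a)·ξ holds μ-almost everywhere for every a ∈ C₀(X, ℂ) and every ξ ∈ L^p(μ, ℂ). In particular π is positive: if a ≥ 0 pointwise, then π(a) maps functions that are nonnegative μ-a.e. to functions that are nonnegative μ-a.e. -/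
open MeasureTheory
open scoped ZeroAtInfty ENNReal

section Pointwise

theorem rpow_add_rpow_lt_rpow_add {q a b : ℝ} (hq : 1 < q) (ha : 0 < a) (hb : 0 < b) :
    a ^ q + b ^ q < (a + b) ^ q := by
  have key : ∀ c : ℝ, 0 < c → c ^ q = c * c ^ (q - 1) := fun c hc => by
    rw [Real.rpow_sub_one hc.ne']; field_simp
  rw [key a ha, key b hb, key (a + b) (by positivity), add_mul]
  gcongr <;> linarith

theorem rpow_add_lt_rpow_add_rpow {q a b : ℝ} (hq : q < 1) (ha : 0 < a) (hb : 0 < b) :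
    (a + b) ^ q < a ^ q + b ^ q := by
  have key : ∀ c : ℝ, 0 < c → c ^ q = c * c ^ (q - 1) := fun c hc => by
    rw [Real.rpow_sub_one hc.ne']; field_simp
  rw [key a ha, key b hb, key (a + b) (by positivity), add_mul]
  have h1 : (a + b) ^ (q - 1) < a ^ (q - 1) :=
    Real.rpow_lt_rpow_of_neg ha (by linarith) (by linarith)
  have h2 : (a + b) ^ (q - 1) < b ^ (q - 1) :=
    Real.rpow_lt_rpow_of_neg hb (by linarith) (by linarith)
  gcongr

theorem norm_rpow_eq_sq_rpow_half (p : ℝ) (z : ℂ) : ‖z‖ ^ p = (‖z‖ ^ 2) ^ (p / 2) := by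
  rw [← Real.rpow_natCast_mul (norm_nonneg z)]
  congr 1
  push_cast
  ring

theorem norm_add_sq_add_norm_sub_sq (z w : ℂ) :
    ‖z + w‖ ^ 2 + ‖z - w‖ ^ 2 = 2 * (‖z‖ ^ 2 + ‖w‖ ^ 2) := by
  have := parallelogram_law_with_norm ℝ z w
  nlinarith

/-- The deviation of `‖·‖ ^ p` from the parallelogram law. -/
noncomputable def clarksonDefect (p : ℝ) (z w : ℂ) : ℝ :=
  ‖z + w‖ ^ p + ‖z - w‖ ^ p - 2 * (‖z‖ ^ p + ‖w‖ ^ p)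

theorem clarksonDefect_eq_zero {p : ℝ} (hp : 0 < p) {z w : ℂ} (h : z * w = 0) :
    clarksonDefect p z w = 0 := by
  unfold clarksonDefect
  rcases mul_eq_zero.1 h with rfl | rfl <;> simp [Real.zero_rpow hp.ne'] <;> ring

theorem clarksonDefect_pos {p : ℝ} (hp : 2 < p) {z w : ℂ} (h : z * w ≠ 0) :
    0 < clarksonDefect p z w := by
  obtain ⟨hz, hw⟩ := mul_ne_zero_iff.1 h
  have h1 := rpow_add_rpow_lt_rpow_add (q := p / 2) (a := ‖z‖ ^ 2) (b := ‖w‖ ^ 2)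
    (by linarith) (by positivity) (by positivity)
  have h2 := (convexOn_rpow (p := p / 2) (by linarith)).2
    (Set.mem_Ici.2 (sq_nonneg ‖z + w‖)) (Set.mem_Ici.2 (sq_nonneg ‖z - w‖))
    (show (0 : ℝ) ≤ 1 / 2 by norm_num) (show (0 : ℝ) ≤ 1 / 2 by norm_num) (by norm_num)
  have h3 : (1 / 2 : ℝ) • ‖z + w‖ ^ 2 + (1 / 2 : ℝ) • ‖z - w‖ ^ 2 = ‖z‖ ^ 2 + ‖w‖ ^ 2 := by
    have := norm_add_sq_add_norm_sub_sq z w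
    simp only [smul_eq_mul]
    linarith
  simp only [h3] at h2
  simp only [clarksonDefect, norm_rpow_eq_sq_rpow_half p]
  simp only [smul_eq_mul] at h2
  linarith

theorem clarksonDefect_neg {p : ℝ} (hp0 : 0 ≤ p) (hp : p < 2) {z w : ℂ} (h : z * w ≠ 0) :
    clarksonDefect p z w < 0 := by
  obtain ⟨hz, hw⟩ := mul_ne_zero_iff.1 h
  have h1 := rpow_add_lt_rpow_add_rpow (q := p / 2) (a := ‖z‖ ^ 2) (b := ‖w‖ ^ 2)
    (by linarith) (by positivity) (by positivity)
  have h2 := (Real.concaveOn_rpow (p := p / 2) (by linarith) (by linarith)).2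
    (Set.mem_Ici.2 (sq_nonneg ‖z + w‖)) (Set.mem_Ici.2 (sq_nonneg ‖z - w‖))
    (show (0 : ℝ) ≤ 1 / 2 by norm_num) (show (0 : ℝ) ≤ 1 / 2 by norm_num) (by norm_num)
  have h3 : (1 / 2 : ℝ) • ‖z + w‖ ^ 2 + (1 / 2 : ℝ) • ‖z - w‖ ^ 2 = ‖z‖ ^ 2 + ‖w‖ ^ 2 := by
    have := norm_add_sq_add_norm_sub_sq z w
    simp only [smul_eq_mul]
    linarith
  simp only [h3] at h2
  simp only [clarksonDefect, norm_rpow_eq_sq_rpow_half p]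
  simp only [smul_eq_mul] at h2
  linarith

end Pointwise

section Disjoint

variable {Ω : Type*} [MeasurableSpace Ω] {μ : Measure Ω} {p : ℝ≥0∞}

theorem Lp_norm_rpow_eq_integral (hp0 : p ≠ 0) (hp : p ≠ ∞) (f : Lp ℂ p μ) :
    ‖f‖ ^ p.toReal = ∫ x, ‖f x‖ ^ p.toReal ∂μ := by
  have hpos : 0 < p.toReal := ENNReal.toReal_pos hp0 hp
  have hnn : 0 ≤ ∫ x, ‖f x‖ ^ p.toReal ∂μ := integral_nonneg fun x => by positivity
  rw [Lp.norm_def, (Lp.memLp f).eLpNorm_eq_integral_rpow_norm hp0 hp,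
    ENNReal.toReal_ofReal (by positivity), Real.rpow_inv_rpow hnn hpos.ne']

theorem integrable_clarksonDefect (hp0 : p ≠ 0) (hp : p ≠ ∞) (f g : Lp ℂ p μ) :
    Integrable (fun x => clarksonDefect p.toReal (f x) (g x)) μ ∧
    ∫ x, clarksonDefect p.toReal (f x) (g x) ∂μ =
      ‖f + g‖ ^ p.toReal + ‖f - g‖ ^ p.toReal - 2 * (‖f‖ ^ p.toReal + ‖g‖ ^ p.toReal) := by
  have hi : ∀ h : Lp ℂ p μ, Integrable (fun x => ‖h x‖ ^ p.toReal) μ := fun h =>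
    (Lp.memLp h).integrable_norm_rpow hp0 hp
  have hae : (fun x => ‖(f + g) x‖ ^ p.toReal + ‖(f - g) x‖ ^ p.toReal
      - 2 * (‖f x‖ ^ p.toReal + ‖g x‖ ^ p.toReal))
      =ᵐ[μ] fun x => clarksonDefect p.toReal (f x) (g x) := by
    filter_upwards [Lp.coeFn_add f g, Lp.coeFn_sub f g] with x h1 h2
    simp only [h1, h2, clarksonDefect, Pi.add_apply, Pi.sub_apply]
  have hs : Integrable (fun x => ‖(f + g) x‖ ^ p.toReal + ‖(f - g) x‖ ^ p.toReal) μ :=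
    (hi (f + g)).add (hi (f - g))
  have ht : Integrable (fun x => 2 * (‖f x‖ ^ p.toReal + ‖g x‖ ^ p.toReal)) μ :=
    ((hi f).add (hi g)).const_mul 2
  refine ⟨(hs.sub ht).congr hae, ?_⟩
  rw [← integral_congr_ae hae]
  simp only [Lp_norm_rpow_eq_integral hp0 hp]
  rw [← integral_add (hi f) (hi g), ← integral_const_mul, ← integral_add (hi _) (hi _),
    ← integral_sub hs ht]

/-- Lamperti: linear isometries of `L^p`, `p ≠ 2`, preserve disjointness of supports. -/
theorem isometry_mul_eq_zero (hp0 : p ≠ 0) (hp : p ≠ ∞) (hp2 : p.toReal ≠ 2) [Fact (1 ≤ p)]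
    (U : Lp ℂ p μ →L[ℂ] Lp ℂ p μ) (hU : ∀ f, ‖U f‖ = ‖f‖) {f g : Lp ℂ p μ}
    (hfg : ∀ᵐ x ∂μ, f x * g x = 0) : ∀ᵐ x ∂μ, U f x * U g x = 0 := by
  have hpos : 0 < p.toReal := ENNReal.toReal_pos hp0 hp
  obtain ⟨-, h1⟩ := integrable_clarksonDefect hp0 hp f g
  obtain ⟨h2, h3⟩ := integrable_clarksonDefect hp0 hp (U f) (U g)
  have hz : ∫ x, clarksonDefect p.toReal (U f x) (U g x) ∂μ = 0 := by
    rw [h3, ← map_add, ← map_sub, hU, hU, hU, hU, ← h1]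
    exact integral_eq_zero_of_ae (hfg.mono fun x hx => clarksonDefect_eq_zero hpos hx)
  rcases lt_or_gt_of_ne hp2 with hlt | hgt
  · have hle : ∀ z w : ℂ, 0 ≤ -clarksonDefect p.toReal z w := fun z w => by
      by_cases h : z * w = 0
      · simp [clarksonDefect_eq_zero hpos h]
      · linarith [clarksonDefect_neg hpos.le hlt h]
    have h4 := (integral_eq_zero_iff_of_nonneg (fun x => hle (U f x) (U g x)) h2.neg).1
      (by rw [integral_neg, hz, neg_zero])
    filter_upwards [h4] with x hx
    by_contra h
    have := clarksonDefect_neg hpos.le hlt h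
    simp only [Pi.zero_apply] at hx
    linarith
  · have hle : ∀ z w : ℂ, 0 ≤ clarksonDefect p.toReal z w := fun z w => by
      by_cases h : z * w = 0
      · simp [clarksonDefect_eq_zero hpos h]
      · linarith [clarksonDefect_pos hgt h]
    have h4 := (integral_eq_zero_iff_of_nonneg (fun x => hle (U f x) (U g x)) h2).1 hz
    filter_upwards [h4] with x hx
    by_contra h
    have := clarksonDefect_pos hgt h
    simp only [Pi.zero_apply] at hx
    linarith

end Disjoint


section Representation

theorem ZeroAtInftyContinuousMap.norm_le_iff {X : Type*} [TopologicalSpace X] {a : C₀(X, ℂ)}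
    {M : ℝ} (hM : 0 ≤ M) : ‖a‖ ≤ M ↔ ∀ t, ‖a t‖ ≤ M := by
  rw [← ZeroAtInftyContinuousMap.norm_toBCF_eq_norm, BoundedContinuousFunction.norm_le hM]
  rfl

theorem ZeroAtInftyContinuousMap.norm_apply_le {X : Type*} [TopologicalSpace X] (a : C₀(X, ℂ))
    (t : X) : ‖a t‖ ≤ ‖a‖ :=
  (ZeroAtInftyContinuousMap.norm_le_iff (norm_nonneg a)).1 le_rfl t

variable {X : Type*} [TopologicalSpace X]

/-- The function `exp a - 1`, for `a` vanishing at infinity. -/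
noncomputable def expSubOne (a : C₀(X, ℂ)) : C₀(X, ℂ) where
  toFun x := Complex.exp (a x) - 1
  continuous_toFun := by fun_prop
  zero_at_infty' := by
    have h : Filter.Tendsto (fun z : ℂ => Complex.exp z - 1) (nhds 0) (nhds 0) := by
      have : Continuous fun z : ℂ => Complex.exp z - 1 := by fun_prop
      simpa using this.tendsto 0
    exact h.comp a.zero_at_infty'

theorem expSubOne_apply (a : C₀(X, ℂ)) (x : X) : expSubOne a x = Complex.exp (a x) - 1 := rfl

theorem tendsto_smul_expSubOne (a : C₀(X, ℂ)) :
    Filter.Tendsto (fun n : ℕ => ((n : ℂ) + 1) • expSubOne (((n : ℂ) + 1)⁻¹ • a))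
      Filter.atTop (nhds a) := by
  rw [tendsto_iff_norm_sub_tendsto_zero]
  have hlim : Filter.Tendsto (fun n : ℕ => ‖a‖ ^ 2 * (1 / ((n : ℝ) + 1))) Filter.atTop
      (nhds 0) := by
    simpa using tendsto_one_div_add_atTop_nhds_zero_nat.const_mul (‖a‖ ^ 2)
  refine squeeze_zero' (Filter.Eventually.of_forall fun n => norm_nonneg _) ?_ hlim
  obtain ⟨N, hN⟩ := exists_nat_ge ‖a‖
  filter_upwards [Filter.eventually_ge_atTop N] with n hn
  rw [ZeroAtInftyContinuousMap.norm_le_iff (by positivity)]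
  intro x
  have hn' : (N : ℝ) ≤ n := by exact_mod_cast hn
  have hc : ((n : ℂ) + 1) ≠ 0 := by exact_mod_cast n.succ_ne_zero
  have hnorm : ‖(n : ℂ) + 1‖ = (n : ℝ) + 1 := by
    have : (n : ℂ) + 1 = ((n + 1 : ℕ) : ℂ) := by push_cast; rfl
    rw [this, Complex.norm_natCast]; push_cast; rfl
  have hpos : (0 : ℝ) < n + 1 := by positivity
  set z : ℂ := ((n : ℂ) + 1)⁻¹ * a x with hz
  have hzn : ‖z‖ = ‖a x‖ / (n + 1) := by
    rw [hz, norm_mul, norm_inv, hnorm]; field_simp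
  have hax := ZeroAtInftyContinuousMap.norm_apply_le a x
  have hz1 : ‖z‖ ≤ 1 := by rw [hzn, div_le_one hpos]; linarith
  have heq : (((n : ℂ) + 1) • expSubOne (((n : ℂ) + 1)⁻¹ • a) - a) x
      = ((n : ℂ) + 1) * (Complex.exp z - 1 - z) := by
    have : ((n : ℂ) + 1) * z = a x := by rw [hz, mul_inv_cancel_left₀ hc]
    rw [mul_sub, this]
    rfl
  rw [heq, norm_mul, hnorm]
  calc ((n : ℝ) + 1) * ‖Complex.exp z - 1 - z‖ ≤ ((n : ℝ) + 1) * ‖z‖ ^ 2 := by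
        gcongr; exact Complex.norm_exp_sub_one_sub_id_le hz1
    _ = ‖a x‖ ^ 2 * (1 / ((n : ℝ) + 1)) := by rw [hzn]; field_simp
    _ ≤ ‖a‖ ^ 2 * (1 / ((n : ℝ) + 1)) := by gcongr

theorem exists_compact_norm_mul_sub_le (b : C₀(X, ℂ)) {ε : ℝ} (hε : 0 < ε) :
    ∃ K : Set X, IsCompact K ∧ ∀ e : C₀(X, ℂ), ‖e‖ ≤ 1 → (∀ x ∈ K, e x = 1) →
      ‖e * b - b‖ ≤ ε := by
  have h := b.zero_at_infty'.eventually (Metric.ball_mem_nhds (0 : ℂ) (half_pos hε))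
  obtain ⟨K, hK, hKb⟩ := Filter.mem_cocompact.1 h
  refine ⟨K, hK, fun e he heK => ?_⟩
  rw [ZeroAtInftyContinuousMap.norm_le_iff hε.le]
  intro x
  change ‖e x * b x - b x‖ ≤ ε
  by_cases hx : x ∈ K
  · simp [heK x hx, hε.le]
  · have h1 : ‖b x‖ < ε / 2 := by simpa using hKb hx
    have h2 : ‖e x‖ ≤ 1 := (ZeroAtInftyContinuousMap.norm_apply_le e x).trans he
    calc ‖e x * b x - b x‖ ≤ ‖e x * b x‖ + ‖b x‖ := norm_sub_le _ _
      _ ≤ 1 * ‖b x‖ + ‖b x‖ := by rw [norm_mul]; gcongr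
      _ ≤ ε := by linarith

theorem exists_norm_le_one_eq_one_on [LocallyCompactSpace X] [T2Space X] {K : Set X} (hK : IsCompact K) :
    ∃ e : C₀(X, ℂ), ‖e‖ ≤ 1 ∧ ∀ x ∈ K, e x = 1 := by
  obtain ⟨f, hf1, -, hfc, hf⟩ := exists_continuous_one_zero_of_isCompact hK isClosed_empty
    (Set.disjoint_empty K)
  have hc : HasCompactSupport fun x => ((f x : ℝ) : ℂ) :=
    hfc.comp_left (g := fun r : ℝ => (r : ℂ)) Complex.ofReal_zero
  refine ⟨⟨⟨fun x => (f x : ℂ), by fun_prop⟩, hc.is_zero_at_infty⟩, ?_, fun x hx => ?_⟩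
  · rw [ZeroAtInftyContinuousMap.norm_le_iff zero_le_one]
    intro t
    change ‖((f t : ℝ) : ℂ)‖ ≤ 1
    rw [Complex.norm_real, Real.norm_of_nonneg (hf t).1]
    exact (hf t).2
  · change ((f x : ℝ) : ℂ) = 1
    rw [hf1 hx]
    simp

variable {E : Type*} [NormedAddCommGroup E] [NormedSpace ℂ E]
  (π : C₀(X, ℂ) →ₙₐ[ℂ] (E →L[ℂ] E)) (hcontr : ∀ a : C₀(X, ℂ), ‖π a‖ ≤ ‖a‖)
  (hnondeg : (Submodule.span ℂ {ξ : E | ∃ (a : C₀(X, ℂ)) (g : E), π a g = ξ}).topologicalClosure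
      = ⊤)

include hcontr hnondeg

theorem exists_compact_norm_rep_sub_le (ξ : E) {ε : ℝ} (hε : 0 < ε) :
    ∃ K : Set X, IsCompact K ∧ ∀ e : C₀(X, ℂ), ‖e‖ ≤ 1 → (∀ x ∈ K, e x = 1) →
      ‖π e ξ - ξ‖ ≤ ε := by
  have hspan : ∀ η ∈ Submodule.span ℂ {ξ : E | ∃ (a : C₀(X, ℂ)) (g : E), π a g = ξ},
      ∀ ε > 0, ∃ K : Set X, IsCompact K ∧ ∀ e : C₀(X, ℂ), ‖e‖ ≤ 1 → (∀ x ∈ K, e x = 1) →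
        ‖π e η - η‖ ≤ ε := by
    intro η hη
    induction hη using Submodule.closure_induction with
    | zero => exact fun ε hε => ⟨∅, isCompact_empty, fun e _ _ => by simp [hε.le]⟩
    | add x y _ _ hx hy =>
      intro ε hε
      obtain ⟨K, hK, h1⟩ := hx (ε / 2) (half_pos hε)
      obtain ⟨L, hL, h2⟩ := hy (ε / 2) (half_pos hε)
      refine ⟨K ∪ L, hK.union hL, fun e he heK => ?_⟩
      have h1' := h1 e he fun x hx => heK x (Or.inl hx)
      have h2' := h2 e he fun x hx => heK x (Or.inr hx)
      rw [map_add, add_sub_add_comm]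
      exact (norm_add_le _ _).trans (by linarith)
    | smul_mem c x hx =>
      intro ε hε
      obtain ⟨b, g, rfl⟩ := hx
      have hd : 0 < ‖c‖ * ‖g‖ + 1 := by positivity
      obtain ⟨K, hK, h⟩ := exists_compact_norm_mul_sub_le b (div_pos hε hd)
      refine ⟨K, hK, fun e he heK => ?_⟩
      have heq : π e (c • π b g) - c • π b g = c • π (e * b - b) g := by
        rw [map_smul, map_sub, map_mul, ← smul_sub]; rfl
      rw [heq, norm_smul]
      calc ‖c‖ * ‖π (e * b - b) g‖ ≤ ‖c‖ * ((ε / (‖c‖ * ‖g‖ + 1)) * ‖g‖) := by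
            gcongr
            exact ((π _).le_of_opNorm_le ((hcontr _).trans (h e he heK)) g)
        _ = ε * ((‖c‖ * ‖g‖) / (‖c‖ * ‖g‖ + 1)) := by ring
        _ ≤ ε * 1 := by
            gcongr
            rw [div_le_one hd]; linarith
        _ = ε := mul_one ε
  have hmem : ξ ∈ closure (Submodule.span ℂ
      {ξ : E | ∃ (a : C₀(X, ℂ)) (g : E), π a g = ξ} : Set E) := by
    rw [← Submodule.topologicalClosure_coe, hnondeg]; trivial
  obtain ⟨η, hη, hd⟩ := Metric.mem_closure_iff.1 hmem (ε / 3) (by positivity)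
  obtain ⟨K, hK, h⟩ := hspan η hη (ε / 3) (by positivity)
  refine ⟨K, hK, fun e he heK => ?_⟩
  rw [dist_eq_norm] at hd
  have h1 : ‖π e (ξ - η)‖ ≤ ‖ξ - η‖ := by
    simpa using (π e).le_of_opNorm_le ((hcontr e).trans he) (ξ - η)
  have heq : π e ξ - ξ = π e (ξ - η) + (π e η - η) - (ξ - η) := by rw [map_sub]; abel
  rw [heq]
  have h2 := h e he heK
  calc _ ≤ ‖π e (ξ - η)‖ + ‖π e η - η‖ + ‖ξ - η‖ :=
        (norm_sub_le _ _).trans (add_le_add_left (norm_add_le _ _) _)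
    _ ≤ ε := by linarith

variable [LocallyCompactSpace X] [T2Space X]

theorem norm_rep_add_smul_le (a : C₀(X, ℂ)) (c : ℂ) {M : ℝ} (hM : 0 ≤ M)
    (h : ∀ x, ‖a x + c‖ ≤ M) (ξ : E) : ‖π a ξ + c • ξ‖ ≤ M * ‖ξ‖ := by
  refine le_of_forall_pos_le_add fun ε hε => ?_
  have hd : 0 < ‖a‖ + ‖c‖ + 1 := by positivity
  obtain ⟨K, hK, h1⟩ := exists_compact_norm_rep_sub_le π hcontr hnondeg ξ (div_pos hε hd)
  obtain ⟨e, he, heK⟩ := exists_norm_le_one_eq_one_on hK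
  have h2 := h1 e he heK
  have h3 : ‖a * e + c • e‖ ≤ M := by
    rw [ZeroAtInftyContinuousMap.norm_le_iff hM]
    intro x
    change ‖a x * e x + c * e x‖ ≤ M
    rw [← add_mul, norm_mul]
    calc _ ≤ M * 1 := mul_le_mul (h x)
          ((ZeroAtInftyContinuousMap.norm_apply_le e x).trans he) (norm_nonneg _) hM
      _ = M := mul_one M
  have heq : π a ξ + c • ξ
      = π (a * e + c • e) ξ - (π a (π e ξ - ξ) + c • (π e ξ - ξ)) := by
    have : π (a * e + c • e) ξ = π a (π e ξ) + c • π e ξ := by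
      rw [map_add, map_mul, map_smul]; rfl
    rw [this, map_sub, smul_sub]
    abel
  have h4 : ‖π (a * e + c • e) ξ‖ ≤ M * ‖ξ‖ := (π _).le_of_opNorm_le ((hcontr _).trans h3) ξ
  have h5 : ‖π a (π e ξ - ξ)‖ ≤ ‖a‖ * ‖π e ξ - ξ‖ := (π _).le_of_opNorm_le (hcontr _) _
  have h6 : ‖π a (π e ξ - ξ) + c • (π e ξ - ξ)‖ ≤ ε := by
    calc _ ≤ ‖a‖ * ‖π e ξ - ξ‖ + ‖c‖ * ‖π e ξ - ξ‖ :=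
          (norm_add_le _ _).trans (add_le_add h5 (norm_smul_le _ _))
      _ = (‖a‖ + ‖c‖) * ‖π e ξ - ξ‖ := by ring
      _ ≤ (‖a‖ + ‖c‖ + 1) * (ε / (‖a‖ + ‖c‖ + 1)) :=
          mul_le_mul (by linarith) h2 (norm_nonneg _) hd.le
      _ = ε := by field_simp
  rw [heq]
  exact (norm_sub_le _ _).trans (add_le_add h4 h6)

/-- If `1 + v` is unimodular, then `1 + π v` is isometric. -/
theorem norm_add_rep_eq (v : C₀(X, ℂ)) (hv : ∀ x, ‖v x + 1‖ = 1) (ξ : E) :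
    ‖ξ + π v ξ‖ = ‖ξ‖ := by
  have hle : ∀ w : C₀(X, ℂ), (∀ x, ‖w x + 1‖ = 1) → ∀ ξ : E, ‖ξ + π w ξ‖ ≤ ‖ξ‖ := by
    intro w hw ξ
    have := norm_rep_add_smul_le π hcontr hnondeg w 1 zero_le_one (fun x => (hw x).le) ξ
    rwa [one_smul, one_mul, add_comm] at this
  refine le_antisymm (hle v hv ξ) ?_
  have hs : ∀ x, ‖star v x + 1‖ = 1 := fun x => by
    have : star v x + 1 = star (v x + 1) := by simp
    rw [this, norm_star, hv x]
  have hz : v + star v + star v * v = 0 := by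
    ext x
    have h1 : star (v x + 1) * (v x + 1) = 1 := by
      have := Complex.conj_mul' (v x + 1)
      rw [hv x] at this
      simpa using this
    have : star (v x + 1) = star (v x) + 1 := by simp
    rw [this] at h1
    change v x + star (v x) + star (v x) * v x = 0
    linear_combination h1
  have heq : (ξ + π v ξ) + π (star v) (ξ + π v ξ) = ξ := by
    have h0 : π (v + star v + star v * v) ξ = 0 := by rw [hz, map_zero]; rfl
    have h1 : π (v + star v + star v * v) ξ
        = π v ξ + π (star v) ξ + π (star v) (π v ξ) := by
      rw [map_add, map_add, map_mul]; rfl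
    rw [h1] at h0
    rw [map_add]
    calc _ = ξ + (π v ξ + π (star v) ξ + π (star v) (π v ξ)) := by abel
      _ = ξ := by rw [h0, add_zero]
  calc ‖ξ‖ = ‖(ξ + π v ξ) + π (star v) (ξ + π v ξ)‖ := by rw [heq]
    _ ≤ ‖ξ + π v ξ‖ := hle _ hs _

end Representation

section Multiplication

variable {Ω : Type*} [MeasurableSpace Ω] {μ : Measure Ω} {p : ℝ≥0∞} [Fact (1 ≤ p)]

/-- An operator on `L^p` is local if it does not enlarge supports. -/
def IsLocalOperator (T : Lp ℂ p μ →L[ℂ] Lp ℂ p μ) : Prop :=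
  ∀ f g : Lp ℂ p μ, (∀ᵐ x ∂μ, f x * g x = 0) → ∀ᵐ x ∂μ, f x * T g x = 0

theorem IsLocalOperator.add {S T : Lp ℂ p μ →L[ℂ] Lp ℂ p μ} (hS : IsLocalOperator S)
    (hT : IsLocalOperator T) : IsLocalOperator (S + T) := by
  intro f g h
  filter_upwards [hS f g h, hT f g h, Lp.coeFn_add (S g) (T g)] with x h1 h2 h3
  change f x * (S g + T g : Lp ℂ p μ) x = 0
  rw [h3, Pi.add_apply, mul_add, h1, h2, add_zero]

theorem IsLocalOperator.smul {T : Lp ℂ p μ →L[ℂ] Lp ℂ p μ} (hT : IsLocalOperator T) (c : ℂ) :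
    IsLocalOperator (c • T) := by
  intro f g h
  filter_upwards [hT f g h, Lp.coeFn_smul c (T g)] with x h1 h2
  change f x * (c • T g : Lp ℂ p μ) x = 0
  rw [h2, Pi.smul_apply, smul_eq_mul, mul_left_comm, h1, mul_zero]

/-- A local operator commutes with restriction to measurable sets. -/
theorem IsLocalOperator.apply_eq_indicator {T : Lp ℂ p μ →L[ℂ] Lp ℂ p μ}
    (hT : IsLocalOperator T) {A : Set Ω} (hA : MeasurableSet A) (ξ η : Lp ℂ p μ)
    (h : η =ᵐ[μ] A.indicator ξ) : T η =ᵐ[μ] A.indicator (T ξ) := by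
  have hsub : T (ξ - η) =ᵐ[μ] fun x => T ξ x - T η x := by
    rw [map_sub]; exact Lp.coeFn_sub _ _
  have hm : MemLp (Aᶜ.indicator (T η)) p μ := (Lp.memLp (T η)).indicator hA.compl
  have hm' : MemLp (A.indicator (T (ξ - η))) p μ := (Lp.memLp (T (ξ - η))).indicator hA
  have h1 := hT (hm.toLp _) η (by
    filter_upwards [hm.coeFn_toLp, h] with x h1 h2
    rw [h1, h2]
    by_cases hx : x ∈ A <;> simp [hx])
  have h2 := hT (hm'.toLp _) (ξ - η) (by
    filter_upwards [hm'.coeFn_toLp, h, Lp.coeFn_sub ξ η] with x h1 h2 h3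
    rw [h1, h3, Pi.sub_apply, h2]
    by_cases hx : x ∈ A <;> simp [hx])
  filter_upwards [h1, h2, hsub, hm.coeFn_toLp, hm'.coeFn_toLp] with x h1 h2 h3 h4 h5
  rw [h4] at h1
  rw [h5] at h2
  by_cases hx : x ∈ A
  · simp only [Set.indicator_of_mem hx, mul_self_eq_zero, h3, sub_eq_zero] at h2 ⊢
    exact h2.symm
  · have hx' : x ∈ Aᶜ := hx
    simpa only [Set.indicator_of_mem hx', Set.indicator_of_notMem hx, mul_self_eq_zero] using h1

theorem measurable_spanningSetsIndex (μ : Measure Ω) [SigmaFinite μ] :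
    Measurable (spanningSetsIndex μ) :=
  measurable_to_countable' fun n => by
    rw [preimage_spanningSetsIndex_singleton]
    exact MeasurableSet.disjointed (measurableSet_spanningSets μ) n

theorem exists_ae_tendsto_subseq {f : ℕ → Lp ℂ p μ} {g : Lp ℂ p μ}
    (h : Filter.Tendsto f Filter.atTop (nhds g)) :
    ∃ ns : ℕ → ℕ, StrictMono ns ∧
      ∀ᵐ x ∂μ, Filter.Tendsto (fun i => f (ns i) x) Filter.atTop (nhds (g x)) :=
  (tendstoInMeasure_of_tendsto_Lp h).exists_seq_tendsto_ae

/-- A local operator on `L^p` of a σ-finite measure is a multiplication operator. -/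
theorem IsLocalOperator.exists_multiplier [SigmaFinite μ] (hp : p ≠ ∞)
    {T : Lp ℂ p μ →L[ℂ] Lp ℂ p μ} (hT : IsLocalOperator T) :
    ∃ m : Ω → ℂ, Measurable m ∧ ∀ ξ : Lp ℂ p μ, T ξ =ᵐ[μ] fun x => m x * ξ x := by
  let e : ℕ → Lp ℂ p μ := fun n => indicatorConstLp p (measurableSet_spanningSets μ n)
    (measure_spanningSets_lt_top μ n).ne (1 : ℂ)
  have hmeas : ∀ n, Measurable (T (e n)) := fun n => (Lp.stronglyMeasurable _).measurable
  let m : Ω → ℂ := fun x => T (e (spanningSetsIndex μ x)) x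
  have hm : Measurable m := by
    have h : Measurable fun q : ℕ × Ω => T (e q.1) q.2 :=
      measurable_from_prod_countable_right hmeas
    exact Measurable.comp (g := fun q : ℕ × Ω => T (e q.1) q.2) h
      (f := fun x => (spanningSetsIndex μ x, x))
      ((measurable_spanningSetsIndex μ).prodMk measurable_id)
  refine ⟨m, hm, fun ξ => ?_⟩
  induction ξ using Lp.induction hp with
  | indicatorConst c hs hμs =>
    rename_i s
    set ξ : Lp ℂ p μ := indicatorConstLp p hs hμs.ne c
    change T ξ =ᵐ[μ] fun x => m x * ξ x
    have hξs : ξ =ᵐ[μ] s.indicator fun _ => c := indicatorConstLp_coeFn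
    have hall : ∀ᵐ x ∂μ, ∀ n, (spanningSets μ n).indicator (T ξ) x
        = s.indicator (fun y => c * T (e n) y) x := by
      refine ae_all_iff.2 fun n => ?_
      have hmem : MemLp ((spanningSets μ n).indicator ξ) p μ :=
        (Lp.memLp ξ).indicator (measurableSet_spanningSets μ n)
      have h1 := hT.apply_eq_indicator (measurableSet_spanningSets μ n) ξ (hmem.toLp _)
        hmem.coeFn_toLp
      have hen : e n =ᵐ[μ] (spanningSets μ n).indicator fun _ => (1 : ℂ) :=
        indicatorConstLp_coeFn
      have h2 := hT.apply_eq_indicator hs (c • e n) (hmem.toLp _) (by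
        filter_upwards [hmem.coeFn_toLp, hξs, hen, Lp.coeFn_smul c (e n)] with x h1 h2 h3 h4
        rw [h1]
        by_cases hx : x ∈ s <;> by_cases hx' : x ∈ spanningSets μ n <;>
          simp [hx, hx', h2, h3, h4])
      have h3 : T (c • e n) =ᵐ[μ] c • ⇑(T (e n)) := by
        rw [map_smul]; exact Lp.coeFn_smul _ _
      filter_upwards [h1, h2, h3] with x h1 h2 h3
      rw [← h1, h2]
      by_cases hx : x ∈ s
      · rw [Set.indicator_of_mem hx, Set.indicator_of_mem hx, h3]
        rfl
      · rw [Set.indicator_of_notMem hx, Set.indicator_of_notMem hx]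
    filter_upwards [hall, hξs] with x hx hxs
    have := hx (spanningSetsIndex μ x)
    rw [Set.indicator_of_mem (mem_spanningSetsIndex μ x)] at this
    rw [this, hxs]
    by_cases hxs' : x ∈ s <;> simp [hxs', m, mul_comm]
  | add hf hg hfg h1 h2 =>
    rw [map_add]
    filter_upwards [h1, h2, Lp.coeFn_add (T (hf.toLp _)) (T (hg.toLp _)),
      Lp.coeFn_add (hf.toLp _) (hg.toLp _)] with x h1 h2 h3 h4
    rw [h3, h4, Pi.add_apply, Pi.add_apply, h1, h2, mul_add]
  | isClosed =>
    refine IsSeqClosed.isClosed fun f g hf hfg => ?_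
    obtain ⟨ns, hns, h1⟩ := exists_ae_tendsto_subseq hfg
    obtain ⟨ms, hms, h2⟩ := exists_ae_tendsto_subseq
      (((T.continuous.tendsto g).comp hfg).comp hns.tendsto_atTop)
    have h3 : ∀ᵐ x ∂μ, ∀ n, T (f n) x = m x * f n x := ae_all_iff.2 hf
    filter_upwards [h1, h2, h3] with x h1 h2 h3
    refine tendsto_nhds_unique h2 ?_
    have h4 := (h1.comp hms.tendsto_atTop).const_mul (m x)
    refine h4.congr fun i => ?_
    exact (h3 _).symm

/-- The multiplier of a multiplication operator is bounded by the operator norm. -/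
theorem ae_norm_multiplier_le [SigmaFinite μ] (hp : p ≠ ∞) {T : Lp ℂ p μ →L[ℂ] Lp ℂ p μ}
    {m : Ω → ℂ} (hm : Measurable m) (hT : ∀ ξ : Lp ℂ p μ, T ξ =ᵐ[μ] fun x => m x * ξ x)
    {C : ℝ} (hC : 0 ≤ C) (hTC : ∀ ξ, ‖T ξ‖ ≤ C * ‖ξ‖) : ∀ᵐ x ∂μ, ‖m x‖ ≤ C := by
  have hp0 : p ≠ 0 := (zero_lt_one.trans_le Fact.out).ne'
  have hpos : 0 < p.toReal := ENNReal.toReal_pos hp0 hp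
  have hle : (fun x => ‖m x‖ₑ ^ p.toReal) ≤ᵐ[μ] fun _ => ENNReal.ofReal C ^ p.toReal := by
    refine ae_le_of_forall_setLIntegral_le_of_sigmaFinite (by fun_prop) fun s hs hμs => ?_
    set ξ : Lp ℂ p μ := indicatorConstLp p hs hμs.ne (1 : ℂ)
    have hξs : ξ =ᵐ[μ] s.indicator fun _ => (1 : ℂ) := indicatorConstLp_coeFn
    have key : ∀ η : Lp ℂ p μ, ‖η‖ₑ ^ p.toReal = ∫⁻ x, ‖η x‖ₑ ^ p.toReal ∂μ := fun η => by
      rw [Lp.enorm_def, eLpNorm_eq_lintegral_rpow_enorm_toReal hp0 hp, one_div,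
        ENNReal.rpow_inv_rpow hpos.ne']
    have h1 : ‖T ξ‖ₑ ≤ ENNReal.ofReal C * ‖ξ‖ₑ := by
      rw [← ofReal_norm, ← ofReal_norm, ← ENNReal.ofReal_mul hC]
      exact ENNReal.ofReal_le_ofReal (hTC ξ)
    have h2 := ENNReal.rpow_le_rpow h1 hpos.le
    rw [ENNReal.mul_rpow_of_nonneg _ _ hpos.le, key, key] at h2
    have h3 : ∫⁻ x, ‖T ξ x‖ₑ ^ p.toReal ∂μ = ∫⁻ x in s, ‖m x‖ₑ ^ p.toReal ∂μ := by
      rw [← lintegral_indicator hs]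
      refine lintegral_congr_ae ?_
      filter_upwards [hT ξ, hξs] with x h1 h2
      rw [h1, h2]
      by_cases hx : x ∈ s <;> simp [hx, hpos]
    have h4 : ∫⁻ x, ‖ξ x‖ₑ ^ p.toReal ∂μ = μ s := by
      rw [← lintegral_indicator_one hs]
      refine lintegral_congr_ae ?_
      filter_upwards [hξs] with x h2
      rw [h2]
      by_cases hx : x ∈ s <;> simp [hx, hpos]
    rw [h3, h4] at h2
    rwa [setLIntegral_const]
  filter_upwards [hle] with x hx
  rw [ENNReal.rpow_le_rpow_iff hpos, ← ofReal_norm] at hx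
  exact (ENNReal.ofReal_le_ofReal_iff hC).1 hx

omit [Fact (1 ≤ p)] in
/-- Multipliers are determined almost everywhere by their action on `L^p`. -/
theorem ae_eq_of_forall_mul_ae_eq [SigmaFinite μ] {m₁ m₂ : Ω → ℂ}
    (h : ∀ ξ : Lp ℂ p μ, (fun x => m₁ x * ξ x) =ᵐ[μ] fun x => m₂ x * ξ x) : m₁ =ᵐ[μ] m₂ := by
  have hall : ∀ᵐ x ∂μ, ∀ n, x ∈ spanningSets μ n → m₁ x = m₂ x := by
    refine ae_all_iff.2 fun n => ?_
    have hn := h (indicatorConstLp p (measurableSet_spanningSets μ n)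
      (measure_spanningSets_lt_top μ n).ne (1 : ℂ))
    filter_upwards [hn, indicatorConstLp_coeFn (p := p) (c := (1 : ℂ))
      (hs := measurableSet_spanningSets μ n)
      (hμs := (measure_spanningSets_lt_top μ n).ne)] with x h1 h2 hx
    simpa [h2, hx] using h1
  filter_upwards [hall] with x hx
  exact hx _ (mem_spanningSetsIndex μ x)

end Multiplication

section Main

variable {X : Type*} [TopologicalSpace X] [LocallyCompactSpace X] [T2Space X]
  {Ω : Type*} [MeasurableSpace Ω] {μ : Measure Ω} {p : ℝ≥0∞} [Fact (1 ≤ p)]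
  (π : C₀(X, ℂ) →ₙₐ[ℂ] (Lp ℂ p μ →L[ℂ] Lp ℂ p μ)) (hcontr : ∀ a : C₀(X, ℂ), ‖π a‖ ≤ ‖a‖)
  (hnondeg : (Submodule.span ℂ
      {ξ : Lp ℂ p μ | ∃ (a : C₀(X, ℂ)) (g : Lp ℂ p μ), π a g = ξ}).topologicalClosure = ⊤)

include hcontr hnondeg

theorem isLocalOperator_rep_of_re_eq_zero (hp : p ≠ ∞) (hp2 : p.toReal ≠ 2) (a : C₀(X, ℂ))
    (ha : ∀ x, (a x).re = 0) : IsLocalOperator (π a) := by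
  intro f g hfg
  have hp0 : p ≠ 0 := (zero_lt_one.trans_le Fact.out).ne'
  let v : ℕ → C₀(X, ℂ) := fun n => expSubOne (((n : ℂ) + 1)⁻¹ • a)
  have hv : ∀ n x, ‖v n x + 1‖ = 1 := fun n x => by
    have hre : (((n : ℂ) + 1)⁻¹ * a x).re = 0 := by
      have : ((n : ℂ) + 1)⁻¹ = (((n : ℝ) + 1)⁻¹ : ℝ) := by push_cast; rfl
      rw [this, Complex.re_ofReal_mul, ha x, mul_zero]
    have heq : v n x + 1 = Complex.exp (((n : ℂ) + 1)⁻¹ * a x) := by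
      simp [v, expSubOne_apply]
    rw [heq, Complex.norm_exp, hre, Real.exp_zero]
  have hU : ∀ n, ∀ᵐ x ∂μ, (f x + π (v n) f x) * (g x + π (v n) g x) = 0 := fun n => by
    have happ : ∀ ξ, (ContinuousLinearMap.id ℂ (Lp ℂ p μ) + π (v n)) ξ = ξ + π (v n) ξ :=
      fun ξ => by rw [add_apply, ContinuousLinearMap.id_apply]
    have h := isometry_mul_eq_zero hp0 hp hp2 (ContinuousLinearMap.id ℂ (Lp ℂ p μ) + π (v n))
      (fun ξ => by rw [happ]; exact norm_add_rep_eq π hcontr hnondeg (v n) (hv n) ξ) hfg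
    rw [happ, happ] at h
    filter_upwards [h, Lp.coeFn_add f (π (v n) f), Lp.coeFn_add g (π (v n) g)] with x h h1 h2
    rwa [h1, h2] at h
  have hcont : Continuous π := by
    refine (LipschitzWith.of_dist_le_mul (K := 1) fun b c => ?_).continuous
    rw [dist_eq_norm, dist_eq_norm, ← map_sub, NNReal.coe_one, one_mul]
    exact hcontr _
  have hlim : ∀ h : Lp ℂ p μ, Filter.Tendsto (fun n : ℕ => ((n : ℂ) + 1) • π (v n) h)
      Filter.atTop (nhds (π a h)) := fun h => by
    have h1 := (hcont.tendsto a).comp (tendsto_smul_expSubOne a)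
    have h2 := ((ContinuousLinearMap.apply ℂ (Lp ℂ p μ) h).continuous.tendsto _).comp h1
    refine h2.congr fun n => ?_
    change π (((n : ℂ) + 1) • v n) h = _
    rw [map_smul]
    rfl
  obtain ⟨ns, hns, h1⟩ := exists_ae_tendsto_subseq (hlim f)
  obtain ⟨ms, hms, h2⟩ := exists_ae_tendsto_subseq ((hlim g).comp hns.tendsto_atTop)
  have hs : ∀ h : Lp ℂ p μ, ∀ᵐ x ∂μ, ∀ n : ℕ,
      (((n : ℂ) + 1) • π (v n) h : Lp ℂ p μ) x = ((n : ℂ) + 1) * π (v n) h x := fun h =>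
    ae_all_iff.2 fun n => Lp.coeFn_smul _ _
  filter_upwards [h1, h2, hs f, hs g, ae_all_iff.2 hU, hfg] with x h1 h2 h3 h4 h5 h6
  have hinv : Filter.Tendsto (fun n : ℕ => ((n : ℂ) + 1)⁻¹) Filter.atTop (nhds 0) := by
    simpa using tendsto_one_div_add_atTop_nhds_zero_nat (𝕜 := ℂ)
  have hk := (hns.tendsto_atTop.comp hms.tendsto_atTop)
  have h1' := h1.comp hms.tendsto_atTop
  have hzero := ((h2.const_mul (f x)).add (h1'.mul_const (g x))).add
    ((hinv.comp hk).mul (h1'.mul h2))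
  have hconst := hzero.congr (f₂ := fun _ => (0 : ℂ)) fun i => by
    simp only [Function.comp_apply, h3, h4]
    have hc : ((ns (ms i) : ℂ) + 1) ≠ 0 := by exact_mod_cast (ns (ms i)).succ_ne_zero
    have := h5 (ns (ms i))
    field_simp
    linear_combination ((ns (ms i) : ℂ) + 1) * this - ((ns (ms i) : ℂ) + 1) * h6
  have hfin := tendsto_nhds_unique hconst tendsto_const_nhds
  rcases mul_eq_zero.1 h6 with h | h
  · simp [h]
  · simpa [h] using hfin

theorem isLocalOperator_rep (hp : p ≠ ∞) (hp2 : p.toReal ≠ 2) (a : C₀(X, ℂ)) :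
    IsLocalOperator (π a) := by
  have hz : ∀ z : ℂ, (z - star z).re = 0 ∧ (Complex.I * (z + star z)).re = 0 := fun z => by
    simp
  have h1 := isLocalOperator_rep_of_re_eq_zero π hcontr hnondeg hp hp2 (a - star a)
    fun x => (hz (a x)).1
  have h2 := isLocalOperator_rep_of_re_eq_zero π hcontr hnondeg hp hp2
    (Complex.I • (a + star a)) fun x => (hz (a x)).2
  have heq : a = (1 / 2 : ℂ) • (a - star a)
      + (-Complex.I / 2) • (Complex.I • (a + star a)) := by
    ext x
    change a x = (1 / 2 : ℂ) * (a x - star (a x))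
      + (-Complex.I / 2) * (Complex.I * (a x + star (a x)))
    linear_combination ((1 / 2) * (a x + star (a x))) * Complex.I_mul_I
  rw [heq, map_add, map_smul, map_smul _ (-Complex.I / 2)]
  exact (h1.smul _).add (h2.smul _)

/-- The multiplier representing `π a` is nonnegative when `a` is. -/
theorem ae_multiplier_nonneg [SigmaFinite μ] (hp : p ≠ ∞) {a : C₀(X, ℂ)}
    (ha : ∀ t, 0 ≤ (a t).re ∧ (a t).im = 0) {m : Ω → ℂ} (hm : Measurable m)
    (h : ∀ ξ : Lp ℂ p μ, π a ξ =ᵐ[μ] fun x => m x * ξ x) :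
    ∀ᵐ x ∂μ, 0 ≤ (m x).re ∧ (m x).im = 0 := by
  have hdisk : ∀ n : ℤ, ∀ᵐ x ∂μ,
      ‖m x + (-(‖a‖ : ℂ) + n * Complex.I)‖ ≤ √(‖a‖ ^ 2 + (n : ℝ) ^ 2) := by
    intro n
    set c : ℂ := -(‖a‖ : ℂ) + n * Complex.I with hc
    have hsup : ∀ t, ‖a t + c‖ ≤ √(‖a‖ ^ 2 + (n : ℝ) ^ 2) := fun t => by
      refine Real.le_sqrt_of_sq_le ?_
      have h1 : (a t).re ≤ ‖a‖ :=
        (Complex.re_le_norm _).trans (ZeroAtInftyContinuousMap.norm_apply_le a t)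
      rw [Complex.sq_norm, Complex.normSq_apply]
      simp [hc, (ha t).2]
      nlinarith [(ha t).1, norm_nonneg a]
    have happ : ∀ ξ, (π a + c • ContinuousLinearMap.id ℂ (Lp ℂ p μ)) ξ = π a ξ + c • ξ :=
      fun ξ => by
        rw [add_apply, smul_apply,
          ContinuousLinearMap.id_apply]
    refine ae_norm_multiplier_le (T := π a + c • ContinuousLinearMap.id ℂ (Lp ℂ p μ)) hp
      (m := fun x => m x + c) (hm.add_const c) (fun ξ => ?_) (Real.sqrt_nonneg _) fun ξ => by
        rw [happ]
        exact norm_rep_add_smul_le π hcontr hnondeg a c (Real.sqrt_nonneg _) hsup ξ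
    rw [happ]
    filter_upwards [h ξ, Lp.coeFn_add (π a ξ) (c • ξ), Lp.coeFn_smul c ξ] with x h1 h2 h3
    rw [h2, Pi.add_apply, h1, h3, Pi.smul_apply, smul_eq_mul]
    ring
  filter_upwards [ae_all_iff.2 hdisk] with x hx
  have key : ∀ n : ℤ,
      (m x).re ^ 2 + (m x).im ^ 2 - 2 * ‖a‖ * (m x).re + 2 * n * (m x).im ≤ 0 := fun n => by
    have h1 := pow_le_pow_left₀ (norm_nonneg _) (hx n) 2
    rw [Real.sq_sqrt (by positivity), Complex.sq_norm, Complex.normSq_apply] at h1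
    simp at h1
    nlinarith
  have him : (m x).im = 0 := by
    by_contra hne
    obtain ⟨n, hn⟩ := exists_int_gt (2 * ‖a‖ * (m x).re / (2 * (m x).im))
    obtain ⟨k, hk⟩ := exists_int_lt (2 * ‖a‖ * (m x).re / (2 * (m x).im))
    rcases lt_or_gt_of_ne hne with hneg | hpos
    · have h1 := key k
      rw [lt_div_iff_of_neg (by linarith)] at hk
      nlinarith [sq_nonneg (m x).re, sq_nonneg (m x).im]
    · have h1 := key n
      rw [div_lt_iff₀ (by linarith)] at hn
      nlinarith [sq_nonneg (m x).re, sq_nonneg (m x).im]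
  refine ⟨?_, him⟩
  by_contra! hneg
  have h0 := key 0
  rw [him] at h0
  nlinarith [norm_nonneg a, mul_nonneg (norm_nonneg a) (neg_nonneg.2 hneg.le), sq_pos_of_neg hneg]

end Main

/-- A non-degenerate representation of `C₀(X, ℂ)` on `L^p(μ, ℂ)`, for `p ∈ [1, ∞)` with
`p ≠ 2` and `μ` σ-finite, acts by multiplication operators: there is a linear multiplicative
map `π₀` into (representatives of) essentially bounded measurable functions with
`‖π₀(a)‖_∞ ≤ ‖a‖_∞`, such that `π(a)ξ = π₀(a)·ξ` μ-a.e.; in particular `π` is positive. -/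
theorem nondegenerate_rep_on_Lp_is_multiplication
    {X : Type*} [TopologicalSpace X] [LocallyCompactSpace X] [T2Space X]
    {Ω : Type*} [MeasurableSpace Ω] (μ : Measure Ω) [SigmaFinite μ]
    (p : ℝ) (hp : 1 ≤ p) (hp2 : p ≠ 2) [Fact (1 ≤ ENNReal.ofReal p)]
    (π : C₀(X, ℂ) →ₙₐ[ℂ] (Lp ℂ (ENNReal.ofReal p) μ →L[ℂ] Lp ℂ (ENNReal.ofReal p) μ))
    (hcontr : ∀ a : C₀(X, ℂ), ‖π a‖ ≤ ‖a‖)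
    (hnondeg : (Submodule.span ℂ
        {ξ : Lp ℂ (ENNReal.ofReal p) μ |
          ∃ (a : C₀(X, ℂ)) (g : Lp ℂ (ENNReal.ofReal p) μ), π a g = ξ}).topologicalClosure
      = ⊤) :
    ∃ π₀ : C₀(X, ℂ) → Ω → ℂ,
      (∀ a : C₀(X, ℂ), Measurable (π₀ a)) ∧
      (∀ a : C₀(X, ℂ), ∀ᵐ x ∂μ, ‖π₀ a x‖ ≤ ‖a‖) ∧
      (∀ a b : C₀(X, ℂ), π₀ (a + b) =ᵐ[μ] fun x => π₀ a x + π₀ b x) ∧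
      (∀ (c : ℂ) (a : C₀(X, ℂ)), π₀ (c • a) =ᵐ[μ] fun x => c * π₀ a x) ∧
      (∀ a b : C₀(X, ℂ), π₀ (a * b) =ᵐ[μ] fun x => π₀ a x * π₀ b x) ∧
      (∀ (a : C₀(X, ℂ)) (ξ : Lp ℂ (ENNReal.ofReal p) μ),
        ⇑(π a ξ) =ᵐ[μ] fun x => π₀ a x * ξ x) ∧
      (∀ a : C₀(X, ℂ), (∀ t : X, 0 ≤ (a t).re ∧ (a t).im = 0) →
        ∀ ξ : Lp ℂ (ENNReal.ofReal p) μ,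
          (∀ᵐ x ∂μ, 0 ≤ (ξ x).re ∧ (ξ x).im = 0) →
          (∀ᵐ x ∂μ, 0 ≤ ((π a ξ : Lp ℂ (ENNReal.ofReal p) μ) x).re ∧
            ((π a ξ : Lp ℂ (ENNReal.ofReal p) μ) x).im = 0)) := by
  have hptop : ENNReal.ofReal p ≠ ∞ := ENNReal.ofReal_ne_top
  have hp2' : (ENNReal.ofReal p).toReal ≠ 2 := by
    rwa [ENNReal.toReal_ofReal (by linarith)]
  choose π₀ hmeas hmul using fun a : C₀(X, ℂ) =>
    (isLocalOperator_rep π hcontr hnondeg hptop hp2' a).exists_multiplier hptop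
  refine ⟨π₀, hmeas, fun a => ?_, fun a b => ?_, fun c a => ?_, fun a b => ?_, hmul,
    fun a ha ξ hξ => ?_⟩
  · exact ae_norm_multiplier_le hptop (hmeas a) (hmul a) (norm_nonneg a)
      fun ξ => (π a).le_of_opNorm_le (hcontr a) ξ
  · refine ae_eq_of_forall_mul_ae_eq (p := ENNReal.ofReal p) fun ξ => ?_
    have h : π (a + b) ξ = π a ξ + π b ξ := by rw [map_add]; rfl
    have hab := hmul (a + b) ξ
    rw [h] at hab
    filter_upwards [hab, hmul a ξ, hmul b ξ, Lp.coeFn_add (π a ξ) (π b ξ)] with x h1 h2 h3 h4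
    rw [← h1, h4, Pi.add_apply, h2, h3, add_mul]
  · refine ae_eq_of_forall_mul_ae_eq (p := ENNReal.ofReal p) fun ξ => ?_
    have h : π (c • a) ξ = c • π a ξ := by rw [map_smul]; rfl
    have hca := hmul (c • a) ξ
    rw [h] at hca
    filter_upwards [hca, hmul a ξ, Lp.coeFn_smul c (π a ξ)] with x h1 h2 h3
    rw [← h1, h3, Pi.smul_apply, h2, smul_eq_mul, mul_assoc]
  · refine ae_eq_of_forall_mul_ae_eq (p := ENNReal.ofReal p) fun ξ => ?_
    have h : π (a * b) ξ = π a (π b ξ) := by rw [map_mul]; rfl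
    have hab := hmul (a * b) ξ
    rw [h] at hab
    filter_upwards [hab, hmul a (π b ξ), hmul b ξ] with x h1 h2 h3
    rw [← h1, h2, h3, mul_assoc]
  · filter_upwards [ae_multiplier_nonneg π hcontr hnondeg hptop ha (hmeas a) (hmul a), hξ,
      hmul a ξ] with x h1 h2 h3
    rw [h3, Complex.mul_re, Complex.mul_im, h1.2, h2.2]
    simpa using mul_nonneg h1.1 h2.1
end

section
/- Let X be a set, φ : X → X a function, and n, m, k, l ∈ ℕ with n ≥ l. Let U, V, W, Y ⊆ X be subsets such that φ^n (the n-fold iterate of φ) is injective on U, φ^m is injective on V, φ^k is injective on Y, φ^l is injective on W, and φ^n(U) = φ^m(V), φ^k(Y) = φ^l(W). Let h₁ : U → V be the bijection h₁ = (φ^m|_V)⁻¹ ∘ φ^n|_U and h₂ : Y → W the bijection h₂ = (φ^l|_W)⁻¹ ∘ φ^k|_Y. Set Y′ := { y ∈ Y : φ^k(y) ∈ φ^l(U ∩ W) } and V′ := { v ∈ V : φ^m(v) ∈ φ^n(U ∩ W) }. Then: (i) for every y ∈ Y′ one has h₂(y) ∈ U ∩ W and φ^{k+n−l}(y) = φ^n(h₂(y));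 (ii) φ^{k+n−l} is injective on Y′; (iii) φ^{k+n−l}(Y′) = φ^n(U ∩ W) = φ^m(V′); (iv) for every y ∈ Y′, h₁(h₂(y)) = (φ^m|_V)⁻¹(φ^{k+n−l}(y)), i.e. the composition h₁ ∘ h₂, restricted to Y′, is again a partial bijection of the same form, mapping Y′ onto V′. -/
open Set Function

/-- The set-theoretic composition law for the partial bijections
`h₁ = (φ^m|_V)⁻¹ ∘ φ^n|_U` and `h₂ = (φ^l|_W)⁻¹ ∘ φ^k|_Y` arising from a singly generated
dynamical system `(X, φ)` (case `n ≥ l`): on `Y′ = {y ∈ Y : φ^k(y) ∈ φ^l(U ∩ W)}` one has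
`h₂(y) ∈ U ∩ W` and `φ^{k+n-l}(y) = φ^n(h₂(y))`; the iterate `φ^{k+n-l}` is injective on `Y′`
with `φ^{k+n-l}(Y′) = φ^n(U ∩ W) = φ^m(V′)` where
`V′ = {v ∈ V : φ^m(v) ∈ φ^n(U ∩ W)}`; and the composition `h₁ ∘ h₂` restricted to `Y′` is
again of the same form, mapping `Y′` bijectively onto `V′` with
`φ^m(h₁(h₂(y))) = φ^{k+n-l}(y)`. -/
theorem deaconu_renault_bisection_composition
    {X : Type*} (φ : X → X) (n m k l : ℕ) (hnl : l ≤ n)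
    (U V W Y : Set X)
    (hU : InjOn (φ^[n]) U) (hV : InjOn (φ^[m]) V)
    (hY : InjOn (φ^[k]) Y) (hW : InjOn (φ^[l]) W)
    (hUV : φ^[n] '' U = φ^[m] '' V) (hYW : φ^[k] '' Y = φ^[l] '' W)
    (h₁ h₂ : X → X)
    (hh₁ : MapsTo h₁ U V) (hh₁' : ∀ x ∈ U, φ^[m] (h₁ x) = φ^[n] x)
    (hh₂ : MapsTo h₂ Y W) (hh₂' : ∀ y ∈ Y, φ^[l] (h₂ y) = φ^[k] y)
    (Y' V' : Set X)
    (hY' : Y' = {y ∈ Y | φ^[k] y ∈ φ^[l] '' (U ∩ W)})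
    (hV' : V' = {x ∈ V | φ^[m] x ∈ φ^[n] '' (U ∩ W)}) :
    (∀ y ∈ Y', h₂ y ∈ U ∩ W ∧ φ^[k + n - l] y = φ^[n] (h₂ y)) ∧
    InjOn (φ^[k + n - l]) Y' ∧
    (φ^[k + n - l] '' Y' = φ^[n] '' (U ∩ W) ∧ φ^[n] '' (U ∩ W) = φ^[m] '' V') ∧
    (∀ y ∈ Y', h₁ (h₂ y) ∈ V' ∧ φ^[m] (h₁ (h₂ y)) = φ^[k + n - l] y) ∧
    (fun y => h₁ (h₂ y)) '' Y' = V' := by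
  have hkn (x : X) : φ^[k + n - l] x = φ^[n - l] (φ^[k] x) := by
    rw [← iterate_add_apply, show n - l + k = k + n - l by omega]
  have hn (x : X) : φ^[n] x = φ^[n - l] (φ^[l] x) := by
    rw [← iterate_add_apply, Nat.sub_add_cancel hnl]
  have h₂_eq {y w : X} (hy : y ∈ Y) (hw : w ∈ W) (h : φ^[l] w = φ^[k] y) : h₂ y = w :=
    hW (hh₂ hy) hw ((hh₂' y hy).trans h.symm)
  have hYmem : ∀ y ∈ Y', y ∈ Y ∧ h₂ y ∈ U ∩ W := by
    subst hY'
    rintro y ⟨hy, w, hw, h⟩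
    exact ⟨hy, by rwa [h₂_eq hy hw.2 h]⟩
  have hiter : ∀ y ∈ Y', φ^[k + n - l] y = φ^[n] (h₂ y) := fun y hy ↦ by
    rw [hkn, hn, hh₂' y (hYmem y hy).1]
  have hsurj : ∀ w ∈ U ∩ W, ∃ y ∈ Y', h₂ y = w := by
    intro w hw
    obtain ⟨y, hy, h⟩ : φ^[l] w ∈ φ^[k] '' Y := hYW ▸ mem_image_of_mem _ hw.2
    exact ⟨y, hY' ▸ ⟨hy, w, hw, h.symm⟩, h₂_eq hy hw.2 h.symm⟩
  have hV₁ : ∀ w ∈ U ∩ W, h₁ w ∈ V' := fun w hw ↦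
    hV' ▸ ⟨hh₁ hw.1, w, hw, (hh₁' w hw.1).symm⟩
  refine ⟨fun y hy ↦ ⟨(hYmem y hy).2, hiter y hy⟩, ?_, ⟨?_, ?_⟩, ?_, ?_⟩
  · intro y hy z hz h
    rw [hiter y hy, hiter z hz] at h
    have hyz : h₂ y = h₂ z := hU (hYmem y hy).2.1 (hYmem z hz).2.1 h
    apply hY (hYmem y hy).1 (hYmem z hz).1
    rw [← hh₂' y (hYmem y hy).1, hyz, hh₂' z (hYmem z hz).1]
  · apply Subset.antisymm
    · rintro _ ⟨y, hy, rfl⟩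
      exact ⟨h₂ y, (hYmem y hy).2, (hiter y hy).symm⟩
    · rintro _ ⟨w, hw, rfl⟩
      obtain ⟨y, hy, rfl⟩ := hsurj w hw
      exact ⟨y, hy, hiter y hy⟩
  · apply Subset.antisymm
    · rintro _ ⟨w, hw, rfl⟩
      exact ⟨h₁ w, hV₁ w hw, hh₁' w hw.1⟩
    · subst hV'
      rintro _ ⟨v, hv, rfl⟩
      exact hv.2
  · intro y hy
    have hw := (hYmem y hy).2
    exact ⟨hV₁ _ hw, by rw [hh₁' _ hw.1, hiter y hy]⟩
  · apply Subset.antisymm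
    · rintro _ ⟨y, hy, rfl⟩
      exact hV₁ _ (hYmem y hy).2
    · subst hV'
      rintro v ⟨hv, w, hw, h⟩
      obtain ⟨y, hy, rfl⟩ := hsurj w hw
      exact ⟨y, hy, hV (hh₁ hw.1) hv ((hh₁' _ hw.1).trans h)⟩
end
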